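/- arXiv:1010.1399 — 2 statements merged into one kernel-verified Lean document; each statement's English description precedes it below -/
import Mathlib

section
/- If the Firoozbakht inequality p_n^(1/n) > p_{n+1}^(1/(n+1)) holds for all sufficiently large n, then there exists N such that for all n > N, p_{n+1} - p_n < (ln p_n)^2 - ln p_n + 1, where p_n denotes the n-th prime. -/
open Filter Real

/-- `p n` is the n-th prime, 1-indexed: `p 1 = 2`. -/
noncomputable def p (n : ℕ) : ℕ := Nat.nth Nat.Prime (n - 1)

/-- terms of the series for `(s-1) ζ(s)` -/
noncomputable def fzE (n : ℕ) (s : ℂ) : ℂ :=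
  (s - 1) * ((n + 1 : ℕ) : ℂ) ^ (-s) + ((n + 2 : ℕ) : ℂ) ^ (1 - s) - ((n + 1 : ℕ) : ℂ) ^ (1 - s)

lemma fz_hasDerivAt_cpow (s : ℂ) {x : ℝ} (hx : 0 < x) :
    HasDerivAt (fun y : ℝ => (y : ℂ) ^ s) (s * (x : ℂ) ^ (s - 1)) x := by
  have h1 : HasDerivAt (fun z : ℂ => z ^ s) (s * (x : ℂ) ^ (s - 1) * 1) (x : ℂ) :=
    (hasDerivAt_id (x : ℂ)).cpow_const (Or.inl (by simpa using hx))
  simpa using h1.comp_ofReal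

lemma fz_cpow_diff_bound (s : ℂ) (hs : 0 ≤ s.re) (n : ℕ) (hn : 1 ≤ n) {x : ℝ}
    (hx : x ∈ Set.Icc (n : ℝ) (n + 1)) :
    ‖(n : ℂ) ^ (-s) - (x : ℂ) ^ (-s)‖ ≤ ‖s‖ * (n : ℝ) ^ (-s.re - 1) := by
  have hn0 : (0 : ℝ) < n := by exact_mod_cast hn
  have key := Convex.norm_image_sub_le_of_norm_hasDerivWithin_le (𝕜 := ℝ)
    (f := fun y : ℝ => (y : ℂ) ^ (-s)) (f' := fun y : ℝ => -s * (y : ℂ) ^ (-s - 1))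
    (s := Set.Icc (n : ℝ) (n + 1)) (C := ‖s‖ * (n : ℝ) ^ (-s.re - 1)) (x := x) (y := n)
    (fun y hy => (fz_hasDerivAt_cpow (-s) (hn0.trans_le hy.1)).hasDerivWithinAt)
    (fun y hy => by
      have hy0 : 0 < y := hn0.trans_le hy.1
      rw [norm_mul, norm_neg, Complex.norm_cpow_eq_rpow_re_of_pos hy0]
      gcongr
      simp only [Complex.sub_re, Complex.neg_re, Complex.one_re]
      exact Real.rpow_le_rpow_of_nonpos hn0 hy.1 (by linarith))
    (convex_Icc _ _) hx ⟨le_rfl, by linarith⟩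
  simp only [Complex.ofReal_natCast] at key
  refine key.trans ?_
  have : ‖(n : ℝ) - x‖ ≤ 1 := by
    rw [Real.norm_eq_abs, abs_le]; constructor <;> linarith [hx.1, hx.2]
  have h0 : 0 ≤ ‖s‖ * (n : ℝ) ^ (-s.re - 1) := by positivity
  nlinarith

lemma fz_cpow_diff_bound' (s : ℂ) (hs : 0 ≤ s.re) (n : ℕ) (hn : 1 ≤ n) {x : ℝ}
    (hx : x ∈ Set.Icc (n : ℝ) (n + 1)) :
    ‖(n : ℂ) ^ (-s) - (x : ℂ) ^ (-s)‖ ≤ 2 * (n : ℝ) ^ (-s.re) := by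
  have hn0 : (0 : ℝ) < n := by exact_mod_cast hn
  have hx0 : 0 < x := hn0.trans_le hx.1
  refine (norm_sub_le _ _).trans ?_
  rw [Complex.norm_cpow_eq_rpow_re_of_pos hx0, Complex.norm_natCast_cpow_of_pos hn]
  simp only [Complex.neg_re]
  have := Real.rpow_le_rpow_of_nonpos hn0 hx.1 (by linarith : -s.re ≤ 0)
  linarith

lemma fz_cpow_diff_bound'' (s : ℂ) (hs : 0 ≤ s.re) (n : ℕ) (hn : 1 ≤ n) {x : ℝ}
    (hx : x ∈ Set.Icc (n : ℝ) (n + 1)) {η : ℝ} (h0 : 0 < η) (h1 : η ≤ 1) :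
    ‖(n : ℂ) ^ (-s) - (x : ℂ) ^ (-s)‖ ≤ 2 * ‖s‖ ^ η * (n : ℝ) ^ (-s.re - η) := by
  have hn0 : (0 : ℝ) < n := by exact_mod_cast hn
  set a := ‖(n : ℂ) ^ (-s) - (x : ℂ) ^ (-s)‖ with ha
  have ha0 : 0 ≤ a := norm_nonneg _
  have b1 := fz_cpow_diff_bound s hs n hn hx
  have b2 := fz_cpow_diff_bound' s hs n hn hx
  have e : a = a ^ η * a ^ (1 - η) := by
    rcases eq_or_lt_of_le ha0 with h | h
    · rw [← h, Real.zero_rpow h0.ne']; simp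
    · rw [← Real.rpow_add h]; simp
  calc a = a ^ η * a ^ (1 - η) := e
    _ ≤ (‖s‖ * (n : ℝ) ^ (-s.re - 1)) ^ η * (2 * (n : ℝ) ^ (-s.re)) ^ (1 - η) := by
        gcongr
    _ = 2 ^ (1 - η) * ‖s‖ ^ η * (n : ℝ) ^ (-s.re - η) := by
        rw [Real.mul_rpow (by positivity) (by positivity),
          Real.mul_rpow (by positivity) (by positivity), ← Real.rpow_mul hn0.le,
          ← Real.rpow_mul hn0.le]
        have : (n : ℝ) ^ (-s.re - η) = (n : ℝ) ^ ((-s.re - 1) * η) * (n : ℝ) ^ (-s.re * (1 - η)) := by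
          rw [← Real.rpow_add hn0]; congr 1; ring
        rw [this]; ring
    _ ≤ 2 * ‖s‖ ^ η * (n : ℝ) ^ (-s.re - η) := by
        gcongr
        calc (2 : ℝ) ^ (1 - η) ≤ 2 ^ (1 : ℝ) :=
              Real.rpow_le_rpow_of_exponent_le (by norm_num) (by linarith)
          _ = 2 := by norm_num

lemma fz_E_bound (s : ℂ) (hs : 0 ≤ s.re) (n : ℕ) {η : ℝ} (h0 : 0 < η) (h1 : η ≤ 1) :
    ‖fzE n s‖ ≤ ‖s - 1‖ * (2 * ‖s‖ ^ η * ((n + 1 : ℕ) : ℝ) ^ (-s.re - η)) := by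
  set m := n + 1 with hm
  have hm1 : 1 ≤ m := by omega
  have hn0 : (0 : ℝ) < m := by exact_mod_cast hm1
  have key := Convex.norm_image_sub_le_of_norm_hasDerivWithin_le (𝕜 := ℝ)
    (f := fun y : ℝ => (s - 1) * (m : ℂ) ^ (-s) * (y : ℂ) + (y : ℂ) ^ (1 - s))
    (f' := fun y : ℝ => (s - 1) * (m : ℂ) ^ (-s) * 1 + (1 - s) * (y : ℂ) ^ (1 - s - 1))
    (s := Set.Icc (m : ℝ) (m + 1))
    (C := ‖s - 1‖ * (2 * ‖s‖ ^ η * (m : ℝ) ^ (-s.re - η))) (x := m) (y := m + 1)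
    (fun y hy => by
      refine HasDerivAt.hasDerivWithinAt ?_
      exact ((hasDerivAt_id (y : ℂ)).comp_ofReal.const_mul _).add
        (fz_hasDerivAt_cpow (1 - s) (hn0.trans_le hy.1)))
    (fun y hy => by
      have : (s - 1) * (m : ℂ) ^ (-s) * 1 + (1 - s) * (y : ℂ) ^ (1 - s - 1)
        = (s - 1) * ((m : ℂ) ^ (-s) - (y : ℂ) ^ (-s)) := by
        rw [show (1 - s - 1 : ℂ) = -s by ring]; ring
      rw [this, norm_mul]
      gcongr
      exact fz_cpow_diff_bound'' s hs m hm1 hy h0 h1)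
    (convex_Icc _ _) ⟨le_rfl, by linarith⟩ ⟨by linarith, le_rfl⟩
  have e : fzE n s = ((s - 1) * (m : ℂ) ^ (-s) * ((m + 1 : ℝ) : ℂ) + ((m + 1 : ℝ) : ℂ) ^ (1 - s))
      - ((s - 1) * (m : ℂ) ^ (-s) * ((m : ℝ) : ℂ) + ((m : ℝ) : ℂ) ^ (1 - s)) := by
    have : ((m + 1 : ℝ) : ℂ) = ((n + 2 : ℕ) : ℂ) := by rw [hm]; push_cast; ring
    rw [fzE, ← hm, ← this]; push_cast; ring
  rw [e]
  simpa using key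

lemma fz_summable_aux {η : ℝ} (h0 : 0 < η) :
    Summable (fun n : ℕ => ((n + 1 : ℕ) : ℝ) ^ (-1 - η)) := by
  have := (Real.summable_nat_rpow (p := -1 - η)).2 (by linarith)
  exact (summable_nat_add_iff (f := fun n : ℕ => (n : ℝ) ^ (-1 - η)) 1).2 this

lemma fz_E_bound2 (s : ℂ) (n : ℕ) {η : ℝ} (h0 : 0 < η) (h1 : η ≤ 1) (hs : 1 - η / 2 ≤ s.re) :
    ‖fzE n s‖ ≤ ‖s - 1‖ * (2 * ‖s‖ ^ η) * ((n + 1 : ℕ) : ℝ) ^ (-1 - η / 2) := by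
  refine (fz_E_bound s (by linarith) n h0 h1).trans ?_
  rw [← mul_assoc]
  refine mul_le_mul_of_nonneg_left ?_ (by positivity)
  exact Real.rpow_le_rpow_of_exponent_le (by exact_mod_cast Nat.le_add_left 1 n) (by linarith)

lemma fz_E_diff (n : ℕ) : Differentiable ℂ (fzE n) := by
  have h1 : ((n + 1 : ℕ) : ℂ) ≠ 0 := by exact_mod_cast Nat.succ_ne_zero n
  have h2 : ((n + 2 : ℕ) : ℂ) ≠ 0 := by exact_mod_cast Nat.succ_ne_zero (n+1)
  unfold fzE
  intro s
  refine DifferentiableAt.sub (DifferentiableAt.add (DifferentiableAt.mul (by fun_prop) ?_) ?_) ?_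
  · exact DifferentiableAt.const_cpow (by fun_prop) (Or.inl h1)
  · exact DifferentiableAt.const_cpow (by fun_prop) (Or.inl h2)
  · exact DifferentiableAt.const_cpow (by fun_prop) (Or.inl h1)

lemma fz_E_hasSum {s : ℂ} (hs : 1 < s.re) :
    HasSum (fun n => fzE n s) (riemannZeta₁ s - 1) := by
  have hs1 : s ≠ 1 := by rintro rfl; simp at hs
  have a1 : HasSum (fun n : ℕ => (s - 1) * ((n + 1 : ℕ) : ℂ) ^ (-s)) ((s - 1) * riemannZeta s) := by
    apply HasSum.mul_left
    rw [zeta_eq_tsum_one_div_nat_add_one_cpow hs]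
    have hsum : Summable (fun n : ℕ => 1 / ((n : ℂ) + 1) ^ s) := by
      have := (Complex.summable_one_div_nat_cpow (p := s)).2 hs
      simpa using (summable_nat_add_iff (f := fun n : ℕ => 1 / (n : ℂ) ^ s) 1).2 this
    have e : (fun n : ℕ => ((n + 1 : ℕ) : ℂ) ^ (-s)) = fun n : ℕ => 1 / ((n : ℂ) + 1) ^ s := by
      ext n
      rw [Complex.cpow_neg]; push_cast; simp
    rw [e]
    exact hsum.hasSum
  have a2 : HasSum (fun n : ℕ => ((n + 2 : ℕ) : ℂ) ^ (1 - s) - ((n + 1 : ℕ) : ℂ) ^ (1 - s)) (-1) := by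
    have hsumm : Summable (fun n : ℕ => ((n + 2 : ℕ) : ℂ) ^ (1 - s) - ((n + 1 : ℕ) : ℂ) ^ (1 - s)) := by
      have hE : Summable (fun n => fzE n s) := by
        refine Summable.of_norm_bounded ?_ (fun n => fz_E_bound2 s n one_pos le_rfl (by linarith))
        exact (fz_summable_aux (by norm_num)).mul_left _
      refine (hE.sub a1.summable).congr fun n => ?_
      rw [fzE]; ring
    have ht := hsumm.hasSum.tendsto_sum_nat
    have : (fun N => ∑ n ∈ Finset.range N, (((n + 2 : ℕ) : ℂ) ^ (1 - s) - ((n + 1 : ℕ) : ℂ) ^ (1 - s)))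
       = fun N => ((N + 1 : ℕ) : ℂ) ^ (1 - s) - 1 := by
      ext N
      have := Finset.sum_range_sub (fun n : ℕ => ((n + 1 : ℕ) : ℂ) ^ (1 - s)) N
      simpa [add_assoc, one_add_one_eq_two] using this
    rw [this] at ht
    have h0 : Tendsto (fun N : ℕ => ((N + 1 : ℕ) : ℂ) ^ (1 - s)) atTop (nhds 0) := by
      rw [tendsto_zero_iff_norm_tendsto_zero]
      have h : ∀ N : ℕ, ‖((N + 1 : ℕ) : ℂ) ^ (1 - s)‖ = ((N + 1 : ℕ) : ℝ) ^ (-(s.re - 1)) := by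
        intro N
        rw [Complex.norm_natCast_cpow_of_pos (Nat.succ_pos N)]; simp
      simp_rw [h]
      exact (tendsto_rpow_neg_atTop (by linarith)).comp
        ((tendsto_natCast_atTop_atTop (R := ℝ)).comp (tendsto_add_atTop_nat 1))
    have := tendsto_nhds_unique ht (h0.sub_const 1)
    rw [← show (0 - 1 : ℂ) = -1 by ring, ← this]
    exact hsumm.hasSum
  have e : riemannZeta₁ s - 1 = (s - 1) * riemannZeta s + (-1) := by
    rw [riemannZeta_eq_inv_sub_mul hs1, mul_inv_cancel_left₀ (sub_ne_zero.2 hs1)]; ring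
  rw [e]
  have e2 : (fun n => fzE n s) = fun n : ℕ => (s - 1) * ((n + 1 : ℕ) : ℂ) ^ (-s) +
      (((n + 2 : ℕ) : ℂ) ^ (1 - s) - ((n + 1 : ℕ) : ℂ) ^ (1 - s)) := by
    ext n; rw [fzE]; ring
  rw [e2]
  exact a1.add a2

lemma fz_zeta1_eq {η : ℝ} (h0 : 0 < η) (h1 : η ≤ 1) {s : ℂ} (hs : 1 - η / 2 < s.re) :
    riemannZeta₁ s = 1 + ∑' n, fzE n s := by
  let U : Set ℂ := {z | 1 - η / 2 < z.re}
  have hUo : IsOpen U := isOpen_lt continuous_const Complex.continuous_re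
  have hUc : IsPreconnected U := (convex_halfSpace_re_gt (1 - η / 2)).isPreconnected
  have hd : DifferentiableOn ℂ (fun z => ∑' n, fzE n z) U := by
    intro z hz
    let V : Set ℂ := U ∩ Metric.ball 0 (‖z‖ + 1)
    have hVo : IsOpen V := hUo.inter Metric.isOpen_ball
    have hzV : z ∈ V := ⟨hz, by simp⟩
    have : DifferentiableOn ℂ (fun z => ∑' n, fzE n z) V := by
      refine Complex.differentiableOn_tsum_of_summable_norm
        (u := fun n : ℕ => ((‖z‖ + 1 + 1) * (2 * (‖z‖ + 1) ^ η)) * ((n + 1 : ℕ) : ℝ) ^ (-1 - η / 2))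
        ((fz_summable_aux (by linarith)).mul_left _)
        (fun n => (fz_E_diff n).differentiableOn) hVo (fun n w hw => ?_)
      refine (fz_E_bound2 w n h0 h1 (le_of_lt hw.1)).trans ?_
      have hw2 : ‖w‖ ≤ ‖z‖ + 1 := by
        have := hw.2
        rw [mem_ball_zero_iff] at this
        exact this.le
      gcongr
      exact (norm_sub_le _ _).trans (by simpa using hw2)
    exact (this.differentiableAt (hVo.mem_nhds hzV)).differentiableWithinAt
  have hf : AnalyticOnNhd ℂ (fun z => 1 + ∑' n, fzE n z) U :=
    (hd.const_add 1).analyticOnNhd hUo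
  have hg : AnalyticOnNhd ℂ riemannZeta₁ U :=
    differentiable_riemannZeta₁.differentiableOn.analyticOnNhd hUo
  have h2 : (2 : ℂ) ∈ U := by
    simp only [U, Set.mem_ofPred_eq, Complex.re_ofNat]; linarith
  refine (hg.eqOn_of_preconnected_of_eventuallyEq hf hUc h2 ?_) hs
  have : {z : ℂ | 1 < z.re} ∈ nhds (2 : ℂ) :=
    (isOpen_lt continuous_const Complex.continuous_re).mem_nhds (by simp)
  filter_upwards [this] with z hz
  rw [(fz_E_hasSum hz).tsum_eq]; ring

lemma fz_zeta_bound {η : ℝ} (h0 : 0 < η) (h1 : η ≤ 1) :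
    ∃ C : ℝ, 1 ≤ C ∧ ∀ s : ℂ, 1 - η / 2 < s.re → s.re ≤ 3 → 1 / 2 ≤ |s.im| →
      ‖riemannZeta s‖ ≤ C * (4 + |s.im|) ^ η := by
  set S := ∑' n : ℕ, ((n + 1 : ℕ) : ℝ) ^ (-1 - η / 2) with hS
  have hsm : Summable (fun n : ℕ => ((n + 1 : ℕ) : ℝ) ^ (-1 - η / 2)) := fz_summable_aux (by linarith)
  have hS0 : 0 ≤ S := tsum_nonneg (fun n => by positivity)
  refine ⟨2 + 2 * S, by linarith, fun s hs hs3 ht => ?_⟩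
  have hs1 : s ≠ 1 := by rintro rfl; norm_num at ht
  have hn : 1 / 2 ≤ ‖s - 1‖ := ht.trans (by simpa using Complex.abs_im_le_norm (s - 1))
  have hsn : ‖s‖ ≤ 4 + |s.im| := by
    refine (Complex.norm_le_abs_re_add_abs_im s).trans ?_
    rw [abs_of_nonneg (by linarith)]; linarith
  have hb : ‖∑' n, fzE n s‖ ≤ ‖s - 1‖ * (2 * ‖s‖ ^ η) * S := by
    rw [hS, ← tsum_mul_left]
    exact tsum_of_norm_bounded (hsm.mul_left _).hasSum (fun n => fz_E_bound2 s n h0 h1 hs.le)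
  have hY : 1 ≤ (4 + |s.im|) ^ η := Real.one_le_rpow (by linarith [abs_nonneg s.im]) h0.le
  have hpos : 0 < ‖s - 1‖ := by linarith
  rw [riemannZeta_eq_inv_sub_mul hs1, fz_zeta1_eq h0 h1 hs, norm_mul, norm_inv, inv_mul_le_iff₀ hpos]
  refine (norm_add_le _ _).trans ?_
  rw [norm_one]
  have hp : ‖s‖ ^ η ≤ (4 + |s.im|) ^ η := by gcongr
  have hb2 : ‖s - 1‖ * (2 * ‖s‖ ^ η) * S ≤ ‖s - 1‖ * (2 * (4 + |s.im|) ^ η) * S := by gcongr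
  have : 1 ≤ ‖s - 1‖ * (2 * (4 + |s.im|) ^ η) := by nlinarith
  nlinarith

lemma fz_Y_close {η : ℝ} (h0 : 0 < η) (h1 : η ≤ 1) {a b : ℝ} (hab : |b| ≤ 2 * |a| + 4) :
    (4 + |b|) ^ η ≤ 2 * (4 + |a|) ^ η := by
  have ha := abs_nonneg a
  have hb := abs_nonneg b
  calc (4 + |b|) ^ η ≤ (2 * (4 + |a|)) ^ η := by gcongr; linarith
    _ = 2 ^ η * (4 + |a|) ^ η := Real.mul_rpow (by norm_num) (by positivity)
    _ ≤ 2 * (4 + |a|) ^ η := by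
        gcongr
        calc (2 : ℝ) ^ η ≤ 2 ^ (1 : ℝ) := Real.rpow_le_rpow_of_exponent_le (by norm_num) h1
          _ = 2 := by norm_num

lemma fz_im_close {z s : ℂ} {r : ℝ} (h : ‖z - s‖ ≤ r) : |z.im - s.im| ≤ r :=
  le_trans (by simpa using Complex.abs_im_le_norm (z - s)) h

lemma fz_re_close {z s : ℂ} {r : ℝ} (h : ‖z - s‖ ≤ r) : |z.re - s.re| ≤ r :=
  le_trans (by simpa using Complex.abs_re_le_norm (z - s)) h

lemma fz_ne_one {s : ℂ} (h : 1 / 2 ≤ |s.im|) : s ≠ 1 := by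
  rintro rfl; norm_num at h

lemma fz_zeta_deriv_bound {η : ℝ} (h0 : 0 < η) (h1 : η ≤ 1) :
    ∃ C : ℝ, 1 ≤ C ∧ ∀ s : ℂ, 1 - η / 4 ≤ s.re → s.re ≤ 5 / 2 → 3 / 4 ≤ |s.im| →
      ‖deriv riemannZeta s‖ ≤ C * (4 + |s.im|) ^ η := by
  obtain ⟨C, hC1, hC⟩ := fz_zeta_bound h0 h1
  refine ⟨2 * C / (η / 8), ?_, fun s hs1 hs2 ht => ?_⟩
  · rw [le_div_iff₀ (by linarith)]; linarith
  have hr : 0 < η / 8 := by linarith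
  have key : ‖deriv riemannZeta s‖ ≤ (C * (2 * (4 + |s.im|) ^ η)) / (η / 8) := by
    have hz : ∀ z ∈ Metric.closedBall s (η / 8), 1 / 2 ≤ |z.im| ∧ 1 - η / 2 < z.re ∧ z.re ≤ 3 ∧
        |z.im| ≤ 2 * |s.im| + 4 := by
      intro z hz
      rw [mem_closedBall_iff_norm] at hz
      have a1 := fz_im_close hz
      have a2 := abs_le.1 (fz_re_close hz)
      have a3 := abs_sub_abs_le_abs_sub s.im z.im
      have a4 := abs_sub_abs_le_abs_sub z.im s.im
      rw [abs_sub_comm] at a3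
      refine ⟨by linarith, by linarith [a2.1], by linarith [a2.2], by linarith [abs_nonneg s.im]⟩
    refine Complex.norm_deriv_le_of_forall_mem_sphere_norm_le hr ?_ ?_
    · refine DifferentiableOn.diffContOnCl ?_
      rw [closure_ball _ hr.ne']
      intro z hz'
      exact (differentiableAt_riemannZeta (fz_ne_one (hz z hz').1)).differentiableWithinAt
    · intro z hz'
      obtain ⟨b1, b2, b3, b4⟩ := hz z (Metric.sphere_subset_closedBall hz')
      refine (hC z b2 b3 b1).trans ?_
      gcongr
      exact fz_Y_close h0 h1 b4
  refine key.trans (le_of_eq ?_)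
  ring

lemma fz_zeta_lip {η : ℝ} (h0 : 0 < η) (h1 : η ≤ 1) :
    ∃ D : ℝ, 1 ≤ D ∧ ∀ (t : ℝ) (K : Set ℂ), Convex ℝ K →
      (∀ z ∈ K, 1 - η / 4 ≤ z.re ∧ z.re ≤ 5 / 2 ∧ 3 / 4 ≤ |z.im| ∧ |z.im| ≤ 2 * |t| + 4) →
      ∀ a ∈ K, ∀ b ∈ K, ‖riemannZeta b - riemannZeta a‖ ≤ D * (4 + |t|) ^ η * ‖b - a‖ := by
  obtain ⟨C, hC1, hC⟩ := fz_zeta_deriv_bound h0 h1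
  refine ⟨C * 2, by linarith, fun t K hK hz a ha b hb => ?_⟩
  refine hK.norm_image_sub_le_of_norm_deriv_le (𝕜 := ℂ) (fun z hz' => ?_) (fun z hz' => ?_) ha hb
  · exact differentiableAt_riemannZeta (fz_ne_one (by linarith [(hz z hz').2.2.1]))
  · obtain ⟨b1, b2, b3, b4⟩ := hz z hz'
    refine (hC z b1 b2 b3).trans ?_
    rw [mul_assoc]
    gcongr
    exact fz_Y_close h0 h1 b4

lemma fz_zeta_real_bound : ∃ K : ℝ, 1 ≤ K ∧ ∀ σ : ℝ, 1 < σ → σ ≤ 2 →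
    ‖riemannZeta (σ : ℂ)‖ ≤ K / (σ - 1) := by
  obtain ⟨K, hK⟩ := (isCompact_Icc (a := (1 : ℝ)) (b := 2)).exists_bound_of_continuousOn
    (f := fun σ : ℝ => riemannZeta₁ (σ : ℂ))
    ((differentiable_riemannZeta₁.continuous.comp Complex.continuous_ofReal).continuousOn)
  refine ⟨max K 1, le_max_right _ _, fun σ h1 h2 => ?_⟩
  have hne : (σ : ℂ) ≠ 1 := by
    intro h; have : σ = 1 := by exact_mod_cast h
    linarith
  have h3 : ‖(σ : ℂ) - 1‖ = σ - 1 := by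
    have : (σ : ℂ) - 1 = ((σ - 1 : ℝ) : ℂ) := by push_cast; ring
    rw [this, Complex.norm_real, Real.norm_of_nonneg (by linarith)]
  rw [riemannZeta_eq_inv_sub_mul hne, norm_mul, norm_inv, h3, inv_mul_eq_div]
  have : 0 < σ - 1 := by linarith
  gcongr
  exact (hK σ ⟨h1.le, h2⟩).trans (le_max_left _ _)

lemma fz_341 {σ : ℝ} (hσ : 1 < σ) (t : ℝ) :
    1 ≤ ‖riemannZeta (σ : ℂ)‖ ^ 3 * ‖riemannZeta (σ + t * Complex.I)‖ ^ 4 *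
      ‖riemannZeta (σ + (2 * t : ℝ) * Complex.I)‖ := by
  have h := DirichletCharacter.norm_LFunction_product_ge_one (N := 1) 1 (x := σ - 1) (by linarith) t
  simp only [DirichletCharacter.LFunctionTrivChar, one_pow, DirichletCharacter.LFunction_modOne_eq,
    norm_mul, norm_pow] at h
  have e1 : (1 + ((σ - 1 : ℝ) : ℂ)) = σ := by push_cast; ring
  have e2 : (1 + ((σ - 1 : ℝ) : ℂ) + Complex.I * t) = σ + t * Complex.I := by push_cast; ring
  have e3 : (1 + ((σ - 1 : ℝ) : ℂ) + 2 * Complex.I * t) = σ + (2 * t : ℝ) * Complex.I := by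
    push_cast; ring
  rw [e3, e2, e1] at h
  exact h

lemma fz_zeta_lower {η : ℝ} (h0 : 0 < η) (h1 : η ≤ 1) :
    ∃ c : ℝ, 0 < c ∧ ∀ s : ℂ, 1 < s.re → s.re ≤ 2 → 1 ≤ |s.im| →
      c / ((4 + |s.im|) ^ η) ^ 4 ≤ ‖riemannZeta s‖ := by
  obtain ⟨C, hC1, hC⟩ := fz_zeta_bound h0 h1
  obtain ⟨K, hK1, hK⟩ := fz_zeta_real_bound
  obtain ⟨D, hD1, hD⟩ := fz_zeta_lip h0 h1
  set M : ℝ := 2 * C * K ^ 3 with hM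
  have hKp : 1 ≤ K ^ 3 := one_le_pow₀ hK1
  have hM1 : 1 ≤ M := by rw [hM]; nlinarith
  set e : ℝ := 1 / (2 * D * M) with he
  have hDM : 1 ≤ D * M := by nlinarith
  have he0 : 0 < e := by rw [he]; positivity
  have he1 : e ≤ 1 := by rw [he, div_le_one (by positivity)]; nlinarith
  have hDe : D * e = 1 / (2 * M) := by rw [he]; field_simp
  -- bound to the right
  have right : ∀ σ t : ℝ, 1 ≤ |t| → 1 + e ^ 4 / ((4 + |t|) ^ η) ^ 5 ≤ σ → σ ≤ 2 →
      e ^ 3 / (M * ((4 + |t|) ^ η) ^ 4) ≤ ‖riemannZeta (σ + t * Complex.I)‖ := by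
    intro σ t ht hσ hσ2
    set y := (4 + |t|) ^ η with hy
    have hy1 : 1 ≤ y := Real.one_le_rpow (by linarith) h0.le
    have hq : 0 < e ^ 4 / y ^ 5 := by positivity
    have hσ1 : 1 < σ := by linarith
    have h341 := fz_341 hσ1 t
    set Z := ‖riemannZeta (σ + t * Complex.I)‖ with hZ
    have b1 := hK σ hσ1 hσ2
    have b2 : ‖riemannZeta (σ + (2 * t : ℝ) * Complex.I)‖ ≤ C * (2 * y) := by
      have := hC (σ + (2 * t : ℝ) * Complex.I) (by simp; linarith) (by simp; linarith)
        (by simp [abs_mul]; linarith)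
      refine this.trans ?_
      gcongr
      refine fz_Y_close h0 h1 ?_
      simp [abs_mul]
    have b3 : 1 ≤ (K / (σ - 1)) ^ 3 * Z ^ 4 * (C * (2 * y)) := by
      refine h341.trans ?_
      have : 0 < σ - 1 := by linarith
      gcongr
    have hs1 : 0 < σ - 1 := by linarith
    have b4 : (σ - 1) ^ 3 ≤ Z ^ 4 * (M * y) := by
      have : (K / (σ - 1)) ^ 3 * Z ^ 4 * (C * (2 * y)) = Z ^ 4 * (M * y) / (σ - 1) ^ 3 := by
        rw [hM]; field_simp
      rw [this, le_div_iff₀ (by positivity)] at b3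
      linarith
    have b5 : (e ^ 4 / y ^ 5) ^ 3 ≤ Z ^ 4 * (M * y) := by
      refine le_trans ?_ b4
      gcongr
      linarith
    have b6 : (e ^ 3 / (M * y ^ 4)) ^ 4 ≤ Z ^ 4 := by
      have : (e ^ 4 / y ^ 5) ^ 3 / (M * y) ≤ Z ^ 4 := by
        rw [div_le_iff₀ (by positivity)]; exact b5
      refine le_trans ?_ this
      have e1 : (e ^ 4 / y ^ 5) ^ 3 / (M * y) = e ^ 12 / (M * y ^ 16) := by field_simp
      have e2 : (e ^ 3 / (M * y ^ 4)) ^ 4 = e ^ 12 / (M ^ 4 * y ^ 16) := by field_simp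
      rw [e1, e2]
      gcongr
      exact le_self_pow₀ hM1 (by norm_num)
    exact le_of_pow_le_pow_left₀ (by norm_num) (norm_nonneg _) b6
  refine ⟨e ^ 3 / (2 * M), by positivity, fun s hs1 hs2 ht => ?_⟩
  set y := (4 + |s.im|) ^ η with hy
  have hy1 : 1 ≤ y := Real.one_le_rpow (by linarith) h0.le
  have hy0 : 0 < y := by linarith
  set σ₀ : ℝ := 1 + e ^ 4 / y ^ 5 with hσ₀
  have hσ₀2 : σ₀ ≤ 2 := by
    have : e ^ 4 / y ^ 5 ≤ 1 := by
      rw [div_le_one (by positivity)]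
      exact (pow_le_one₀ he0.le he1).trans (one_le_pow₀ hy1)
    linarith
  have hs_eq : s = s.re + s.im * Complex.I := (Complex.re_add_im s).symm
  rcases le_or_gt σ₀ s.re with h | h
  · have := right s.re s.im ht h hs2
    rw [← hs_eq] at this
    refine le_trans ?_ this
    rw [div_div]
    have : 0 < M * y ^ 4 := by positivity
    gcongr
    linarith
  · have r := right σ₀ s.im ht le_rfl hσ₀2
    set s₀ : ℂ := σ₀ + s.im * Complex.I with hs₀
    have hl := hD s.im {z | z.re ∈ Set.Icc 1 2 ∧ z.im = s.im} (by
        intro a ha b hb u v hu hv huv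
        refine ⟨?_, ?_⟩
        · have := (convex_Icc (1 : ℝ) 2) ha.1 hb.1 hu hv huv
          simpa using this
        · simp [ha.2, hb.2, ← add_mul, huv])
      (fun z hz => ⟨by linarith [hz.1.1], by linarith [hz.1.2], by rw [hz.2]; linarith,
        by rw [hz.2]; linarith⟩) s ⟨⟨hs1.le, hs2⟩, rfl⟩ s₀ ⟨⟨by simp [hs₀]; linarith, by simpa [hs₀] using hσ₀2⟩, by simp [hs₀]⟩
    have hn : ‖s₀ - s‖ ≤ e ^ 4 / y ^ 5 := by
      have : s₀ - s = ((σ₀ - s.re : ℝ) : ℂ) := by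
        apply Complex.ext <;> simp [hs₀]
      rw [this, Complex.norm_real, Real.norm_of_nonneg (by linarith)]
      linarith
    have hl2 : ‖riemannZeta s₀ - riemannZeta s‖ ≤ e ^ 3 / (2 * M * y ^ 4) := by
      refine hl.trans ?_
      calc D * y * ‖s₀ - s‖ ≤ D * y * (e ^ 4 / y ^ 5) := by gcongr
        _ = (D * e) * e ^ 3 / y ^ 4 := by field_simp
        _ = e ^ 3 / (2 * M * y ^ 4) := by rw [hDe]; field_simp
    have hl3 := norm_sub_norm_le (riemannZeta s₀) (riemannZeta s)
    have : e ^ 3 / (M * y ^ 4) - e ^ 3 / (2 * M * y ^ 4) = e ^ 3 / (2 * M) / y ^ 4 := by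
      field_simp; ring
    linarith

/-- the regular part of the logarithmic derivative of zeta -/
noncomputable def fzH (s : ℂ) : ℂ := -(deriv riemannZeta₁ s / riemannZeta₁ s) - riemannZeta₀ s

lemma fz_zeta1_ne {s : ℂ} (hs : 1 ≤ s.re) : riemannZeta₁ s ≠ 0 := by
  rcases eq_or_ne s 1 with rfl | h
  · simp
  · intro h0
    apply riemannZeta_ne_zero_of_one_le_re hs
    rw [riemannZeta_eq_inv_sub_mul h, h0, mul_zero]

lemma fzH_analyticAt {s : ℂ} (hs : riemannZeta₁ s ≠ 0) : AnalyticAt ℂ fzH s := by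
  have h1 : AnalyticAt ℂ riemannZeta₁ s := differentiable_riemannZeta₁.analyticAt s
  exact ((h1.deriv.div h1 hs).neg).sub (differentiable_riemannZeta₀.analyticAt s)

lemma fzH_eq {s : ℂ} (hs : s ≠ 1) (h : riemannZeta s ≠ 0) :
    fzH s = -(deriv riemannZeta s / riemannZeta s) - riemannZeta s := by
  have h0 : s - 1 ≠ 0 := sub_ne_zero.2 hs
  have h1 : riemannZeta₁ s ≠ 0 := by
    intro h1; apply h; rw [riemannZeta_eq_inv_sub_mul hs, h1, mul_zero]
  have e0 : riemannZeta₀ s = riemannZeta s - (s - 1)⁻¹ := by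
    rw [riemannZeta_eq_inv_sub_add hs]; ring
  rw [fzH, deriv_riemannZeta_eq_neg_inv_sub_sq_mul_add hs, e0, riemannZeta_eq_inv_sub_mul hs]
  field_simp
  ring

lemma fzH_bound_large (k : ℕ) : ∃ C : ℝ, 1 ≤ C ∧ ∀ s : ℂ, 1 < s.re → s.re ≤ 2 → 1 ≤ |s.im| →
    ‖iteratedDeriv k fzH s‖ ≤ C * (4 + |s.im|) ^ (1 / 2 : ℝ) := by
  set η : ℝ := 1 / (10 * (k + 1)) with hη
  have h0 : 0 < η := by rw [hη]; positivity
  have h1 : η ≤ 1 := by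
    rw [hη, div_le_one (by positivity)]; linarith [(Nat.cast_nonneg k : (0 : ℝ) ≤ k)]
  obtain ⟨C, hC1, hC⟩ := fz_zeta_bound h0 h1
  obtain ⟨C', hC'1, hC'⟩ := fz_zeta_deriv_bound h0 h1
  obtain ⟨D, hD1, hD⟩ := fz_zeta_lip h0 h1
  obtain ⟨c, hc0, hc⟩ := fz_zeta_lower h0 h1
  set ρ : ℝ := min (η / 8) (c / (2 * D)) with hρ
  have hρ0 : 0 < ρ := by rw [hρ]; positivity
  set B : ℝ := 4 * C' / c + 2 * C with hB
  refine ⟨max 1 (k.factorial * B / ρ ^ k), le_max_left _ _, fun s hs1 hs2 ht => ?_⟩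
  set y := (4 + |s.im|) ^ η with hy
  have hy1 : 1 ≤ y := Real.one_le_rpow (by linarith) h0.le
  have hy0 : 0 < y := by linarith
  set r := ρ / y ^ 5 with hr
  have hr0 : 0 < r := by positivity
  have hrρ : r ≤ ρ := div_le_self hρ0.le (one_le_pow₀ hy1)
  have hr8 : r ≤ η / 8 := hrρ.trans (min_le_left _ _)
  have hz : ∀ z ∈ Metric.closedBall s r, 1 - η / 4 ≤ z.re ∧ z.re ≤ 5 / 2 ∧ 3 / 4 ≤ |z.im| ∧
      |z.im| ≤ 2 * |s.im| + 4 := by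
    intro z hz
    rw [mem_closedBall_iff_norm] at hz
    have a1 := fz_im_close hz
    have a2 := abs_le.1 (fz_re_close hz)
    have a3 := abs_sub_abs_le_abs_sub s.im z.im
    have a4 := abs_sub_abs_le_abs_sub z.im s.im
    rw [abs_sub_comm] at a3
    refine ⟨by linarith [a2.1], by linarith [a2.2], by linarith, by linarith [abs_nonneg s.im]⟩
  have hlow : ∀ z ∈ Metric.closedBall s r, c / (2 * y ^ 4) ≤ ‖riemannZeta z‖ := by
    intro z hz'
    have hl := hD s.im _ (convex_closedBall s r) hz z hz' s (Metric.mem_closedBall_self hr0.le)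
    have hl2 : D * y * ‖s - z‖ ≤ c / (2 * y ^ 4) := by
      have : ‖s - z‖ ≤ r := by rw [norm_sub_rev]; exact mem_closedBall_iff_norm.1 hz'
      calc D * y * ‖s - z‖ ≤ D * y * r := by gcongr
        _ = D * ρ / y ^ 4 := by rw [hr]; field_simp
        _ ≤ D * (c / (2 * D)) / y ^ 4 := by gcongr; exact min_le_right _ _
        _ = c / (2 * y ^ 4) := by field_simp
    have hl3 := norm_sub_norm_le (riemannZeta s) (riemannZeta z)
    have hl4 := hc s hs1 hs2 ht
    have : c / y ^ 4 - c / (2 * y ^ 4) = c / (2 * y ^ 4) := by field_simp; ring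
    linarith
  have hne : ∀ z ∈ Metric.closedBall s r, riemannZeta z ≠ 0 := by
    intro z hz' h
    have := hlow z hz'
    rw [h, norm_zero] at this
    have : 0 < c / (2 * y ^ 4) := by positivity
    linarith
  have hne1 : ∀ z ∈ Metric.closedBall s r, z ≠ 1 := fun z hz' =>
    fz_ne_one (by linarith [(hz z hz').2.2.1])
  have key : ‖iteratedDeriv k fzH s‖ ≤ k.factorial * (B * y ^ 5) / r ^ k := by
    refine Complex.norm_iteratedDeriv_le_of_forall_mem_sphere_norm_le k hr0 ?_ ?_
    · refine DifferentiableOn.diffContOnCl ?_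
      rw [closure_ball _ hr0.ne']
      intro z hz'
      refine (fzH_analyticAt ?_).differentiableAt.differentiableWithinAt
      intro h1
      apply hne z hz'
      rw [riemannZeta_eq_inv_sub_mul (hne1 z hz'), h1, mul_zero]
    · intro z hz'
      replace hz' := Metric.sphere_subset_closedBall hz'
      obtain ⟨b1, b2, b3, b4⟩ := hz z hz'
      have hY := fz_Y_close h0 h1 b4
      rw [fzH_eq (hne1 z hz') (hne z hz')]
      refine (norm_sub_le _ _).trans ?_
      rw [norm_neg, norm_div]
      have c1 : ‖deriv riemannZeta z‖ ≤ C' * (2 * y) :=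
        (hC' z b1 b2 b3).trans (by gcongr)
      have c2 : ‖riemannZeta z‖ ≤ C * (2 * y) :=
        (hC z (by linarith) (by linarith) (by linarith)).trans (by gcongr)
      have c3 : ‖deriv riemannZeta z‖ / ‖riemannZeta z‖ ≤ C' * (2 * y) / (c / (2 * y ^ 4)) := by
        gcongr
        exact hlow z hz'
      have c4 : C' * (2 * y) / (c / (2 * y ^ 4)) = 4 * C' / c * y ^ 5 := by field_simp; ring
      have c5 : C * (2 * y) ≤ 2 * C * y ^ 5 := by
        have : y ≤ y ^ 5 := le_self_pow₀ hy1 (by norm_num)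
        nlinarith
      calc _ ≤ 4 * C' / c * y ^ 5 + 2 * C * y ^ 5 := by linarith
        _ = B * y ^ 5 := by rw [hB]; ring
  have hyk : y ^ (5 * (k + 1)) = (4 + |s.im|) ^ (1 / 2 : ℝ) := by
    rw [hy, ← Real.rpow_natCast, ← Real.rpow_mul (by positivity)]
    congr 1
    rw [hη]; push_cast; field_simp; norm_num
  have e : k.factorial * (B * y ^ 5) / r ^ k = k.factorial * B / ρ ^ k * y ^ (5 * (k + 1)) := by
    rw [hr, div_pow, ← pow_mul]
    field_simp
    ring
  rw [e, hyk] at key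
  refine key.trans ?_
  gcongr
  exact le_max_right _ _

lemma fzH_bound (k : ℕ) : ∃ C : ℝ, 1 ≤ C ∧ ∀ s : ℂ, 1 < s.re → s.re ≤ 2 →
    ‖iteratedDeriv k fzH s‖ ≤ C * (4 + |s.im|) ^ (1 / 2 : ℝ) := by
  obtain ⟨C, hC1, hC⟩ := fzH_bound_large k
  have hK : IsCompact (Set.Icc (1 : ℝ) 2 ×ℂ Set.Icc (-1 : ℝ) 1) :=
    isCompact_Icc.reProdIm isCompact_Icc
  obtain ⟨K, hK⟩ := hK.exists_bound_of_continuousOn (f := iteratedDeriv k fzH) (by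
    intro z hz
    rw [iteratedDeriv_eq_iterate]
    exact ((fzH_analyticAt (fz_zeta1_ne hz.1.1)).iterated_deriv k).continuousAt.continuousWithinAt)
  refine ⟨max C K, hC1.trans (le_max_left _ _), fun s h1 h2 => ?_⟩
  have hY : 1 ≤ (4 + |s.im|) ^ (1 / 2 : ℝ) :=
    Real.one_le_rpow (by linarith [abs_nonneg s.im]) (by norm_num)
  rcases le_total 1 |s.im| with h | h
  · refine (hC s h1 h2 h).trans ?_
    gcongr
    exact le_max_left _ _
  · have := hK s ⟨⟨h1.le, h2⟩, abs_le.1 h⟩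
    have h3 : K ≤ max C K := le_max_right _ _
    have h4 : 0 ≤ max C K := by linarith [le_max_left C K]
    nlinarith

open MeasureTheory in
lemma fz_int_maj : Integrable (fun ξ : ℝ => ((1 : ℝ) + ξ ^ 2) ^ (-(3 / 4) : ℝ)) := by
  have := integrable_rpow_neg_one_add_norm_sq (E := ℝ) (μ := volume) (r := 3 / 2)
    (by simp; norm_num)
  refine this.congr (Eventually.of_forall fun ξ => ?_)
  simp only [Real.norm_eq_abs, sq_abs]
  norm_num

/-- the point on the vertical line -/
noncomputable def fzs (c ξ : ℝ) : ℂ := (c : ℂ) + (2 * π * ξ : ℝ) * Complex.I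

lemma fzs_re (c ξ : ℝ) : (fzs c ξ).re = c := by simp [fzs]
lemma fzs_im (c ξ : ℝ) : (fzs c ξ).im = 2 * π * ξ := by simp [fzs]

lemma fzs_cont (c : ℝ) : Continuous (fzs c) := by unfold fzs; fun_prop

lemma fzs_norm {c : ℝ} (hc : 1 ≤ c) (ξ : ℝ) : 1 + ξ ^ 2 ≤ ‖fzs c ξ * (fzs c ξ + 1)‖ := by
  have hp : 1 ≤ 2 * π := by linarith [Real.pi_gt_three]
  have h1 : 1 + ξ ^ 2 ≤ ‖fzs c ξ‖ ^ 2 := by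
    rw [Complex.sq_norm, Complex.normSq_apply, fzs_re, fzs_im]
    have : ξ ^ 2 ≤ (2 * π * ξ) ^ 2 := by
      rw [mul_pow]; nlinarith [sq_nonneg ξ, one_le_pow₀ hp (n := 2)]
    nlinarith
  have h2 : ‖fzs c ξ‖ ≤ ‖fzs c ξ + 1‖ := by
    apply le_of_sq_le_sq _ (norm_nonneg _)
    rw [Complex.sq_norm, Complex.sq_norm, Complex.normSq_apply, Complex.normSq_apply]
    simp only [Complex.add_re, Complex.add_im, Complex.one_re, Complex.one_im, fzs_re, fzs_im]
    nlinarith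
  rw [norm_mul]
  nlinarith [norm_nonneg (fzs c ξ)]

lemma fzs_ne {c : ℝ} (hc : 1 ≤ c) (ξ : ℝ) : fzs c ξ * (fzs c ξ + 1) ≠ 0 := by
  intro h
  have := fzs_norm hc ξ
  rw [h, norm_zero] at this
  nlinarith [sq_nonneg ξ]

open MeasureTheory in
lemma fz_int_ker {c : ℝ} (hc : 1 ≤ c) :
    Integrable (fun ξ : ℝ => 1 / (fzs c ξ * (fzs c ξ + 1))) := by
  refine fz_int_maj.mono' ?_ (Eventually.of_forall fun ξ => ?_)
  · refine Continuous.aestronglyMeasurable ?_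
    refine continuous_const.div ?_ (fzs_ne hc)
    have := fzs_cont c
    fun_prop
  · have h1 : 1 ≤ 1 + ξ ^ 2 := by nlinarith [sq_nonneg ξ]
    rw [norm_div, norm_one]
    calc 1 / ‖fzs c ξ * (fzs c ξ + 1)‖ ≤ 1 / (1 + ξ ^ 2) := by
          gcongr
          exact fzs_norm hc ξ
      _ = (1 + ξ ^ 2) ^ (-1 : ℝ) := by rw [Real.rpow_neg_one, one_div]
      _ ≤ _ := Real.rpow_le_rpow_of_exponent_le h1 (by norm_num)

/-- the Fourier kernel -/
noncomputable def fzK (c v : ℝ) : ℂ := ((Real.exp (-c * v) * max (1 - Real.exp (-v)) 0 : ℝ) : ℂ)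

lemma fzK_cont (c : ℝ) : Continuous (fzK c) := by
  unfold fzK; fun_prop

lemma fzK_ind (c v : ℝ) : fzK c v = (Set.Ioi (0 : ℝ)).indicator
    (fun v : ℝ => Complex.exp (-(c : ℂ) * v) - Complex.exp (-(c + 1 : ℂ) * v)) v := by
  by_cases hv : 0 < v
  · rw [Set.indicator_of_mem (by exact hv), fzK, max_eq_left]
    · rw [show (-(c + 1 : ℂ) * v) = -c * v + - v by ring, Complex.exp_add]
      push_cast; ring
    · have := Real.exp_le_one_iff.2 (by linarith : -v ≤ 0)
      linarith
  · rw [Set.indicator_of_notMem (by simpa using hv), fzK, max_eq_right]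
    · simp
    · have := Real.one_le_exp_iff.2 (by linarith : 0 ≤ -v)
      linarith

open MeasureTheory in
lemma fzK_integrable {c : ℝ} (hc : 1 ≤ c) : Integrable (fzK c) := by
  have : fzK c = (Set.Ioi (0 : ℝ)).indicator
    (fun v : ℝ => Complex.exp (-(c : ℂ) * v) - Complex.exp (-(c + 1 : ℂ) * v)) := by
    ext v; exact fzK_ind c v
  rw [this, integrable_indicator_iff measurableSet_Ioi]
  exact (integrableOn_exp_mul_complex_Ioi (by simp; linarith) 0).sub
    (integrableOn_exp_mul_complex_Ioi (by simp; linarith) 0)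

open MeasureTheory FourierTransform in
lemma fzK_fourier {c : ℝ} (hc : 1 ≤ c) (ξ : ℝ) :
    𝓕 (fzK c) ξ = 1 / (fzs c ξ * (fzs c ξ + 1)) := by
  rw [Real.fourier_real_eq_integral_exp_smul]
  have e : (fun v : ℝ => Complex.exp (((-2 * π * v * ξ : ℝ) : ℂ) * Complex.I) • fzK c v) =
      (Set.Ioi (0 : ℝ)).indicator
      (fun v : ℝ => Complex.exp (-(fzs c ξ) * v) - Complex.exp (-(fzs c ξ + 1) * v)) := by
    ext v
    rw [fzK_ind]
    by_cases hv : v ∈ Set.Ioi (0 : ℝ)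
    · rw [Set.indicator_of_mem hv, Set.indicator_of_mem hv, smul_eq_mul, mul_sub, ← Complex.exp_add,
        ← Complex.exp_add]
      congr 2 <;> (rw [fzs]; push_cast; ring)
    · rw [Set.indicator_of_notMem hv, Set.indicator_of_notMem hv, smul_zero]
  have h1 : (-(fzs c ξ)).re < 0 := by simp [fzs_re]; linarith
  have h2 : (-(fzs c ξ + 1)).re < 0 := by simp [fzs_re]; linarith
  rw [e, integral_indicator measurableSet_Ioi,
    integral_sub (integrableOn_exp_mul_complex_Ioi h1 0) (integrableOn_exp_mul_complex_Ioi h2 0),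
    integral_exp_mul_complex_Ioi h1, integral_exp_mul_complex_Ioi h2]
  have hne := fzs_ne hc ξ
  have n1 : fzs c ξ ≠ 0 := left_ne_zero_of_mul hne
  have n2 : fzs c ξ + 1 ≠ 0 := right_ne_zero_of_mul hne
  have n3 : -fzs c ξ - 1 ≠ 0 := by
    intro h; apply n2; linear_combination -h
  simp only [Complex.ofReal_zero, mul_zero, Complex.exp_zero]
  field_simp
  ring

open MeasureTheory FourierTransform in
lemma fzK_inv {c : ℝ} (hc : 1 ≤ c) (v : ℝ) :
    ∫ ξ : ℝ, Complex.exp (fzs c ξ * v) / (fzs c ξ * (fzs c ξ + 1)) =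
      ((max (1 - Real.exp (-v)) 0 : ℝ) : ℂ) := by
  have hF : 𝓕 (fzK c) = fun ξ : ℝ => 1 / (fzs c ξ * (fzs c ξ + 1)) := by
    ext ξ; exact fzK_fourier hc ξ
  have h := congrFun ((fzK_cont c).fourierInv_fourier_eq (fzK_integrable hc)
    (by rw [hF]; exact fz_int_ker hc)) v
  rw [Real.fourierInv_eq', hF] at h
  have e : ∀ ξ : ℝ, Complex.exp (fzs c ξ * v) / (fzs c ξ * (fzs c ξ + 1)) =
      Complex.exp (c * v) * (Complex.exp (((2 * π * inner ℝ ξ v : ℝ) : ℂ) * Complex.I) •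
        (1 / (fzs c ξ * (fzs c ξ + 1)))) := by
    intro ξ
    rw [smul_eq_mul, ← mul_assoc, ← Complex.exp_add, mul_one_div]
    congr 2
    rw [fzs]
    simp
    ring
  simp_rw [e]
  rw [integral_const_mul, h, fzK]
  push_cast
  rw [← mul_assoc, ← Complex.exp_add]
  simp

/-- coefficients `(Λ(n) - 1) log^k n` -/
noncomputable def fzb (k n : ℕ) : ℝ := (ArithmeticFunction.vonMangoldt n - 1) * (Real.log n) ^ k

lemma fz_logMul (k : ℕ) : LSeries.logMul^[k] (fun n : ℕ => ((ArithmeticFunction.vonMangoldt n : ℝ) : ℂ) - 1)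
    = fun n => (fzb k n : ℂ) := by
  induction k with
  | zero => ext n; simp [fzb]
  | succ k ih =>
    rw [Function.iterate_succ', Function.comp_apply, ih]
    ext n
    simp only [LSeries.logMul, fzb, ← Complex.natCast_log]
    push_cast
    ring

lemma fz_summable1 {s : ℂ} (hs : 1 < s.re) :
    LSeriesSummable (fun n : ℕ => ((ArithmeticFunction.vonMangoldt n : ℝ) : ℂ) - 1) s := by
  have := (ArithmeticFunction.LSeriesSummable_vonMangoldt hs).sub (LSeriesSummable_one_iff.2 hs)
  exact this

lemma fz_LSeries1 {s : ℂ} (hs : 1 < s.re) :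
    LSeries (fun n : ℕ => ((ArithmeticFunction.vonMangoldt n : ℝ) : ℂ) - 1) s = fzH s := by
  have hs1 : s ≠ 1 := by rintro rfl; simp at hs
  rw [fzH_eq hs1 (riemannZeta_ne_zero_of_one_le_re hs.le)]
  have := LSeries_sub (ArithmeticFunction.LSeriesSummable_vonMangoldt hs) (LSeriesSummable_one_iff.2 hs)
  rw [ArithmeticFunction.LSeries_vonMangoldt_eq_deriv_riemannZeta_div hs, LSeries_one_eq_riemannZeta hs] at this
  rw [← neg_div, ← this]
  rfl

lemma fz_absc {s : ℂ} (hs : 1 < s.re) :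
    LSeries.abscissaOfAbsConv (fun n : ℕ => ((ArithmeticFunction.vonMangoldt n : ℝ) : ℂ) - 1) < s.re := by
  have : LSeries.abscissaOfAbsConv (fun n : ℕ => ((ArithmeticFunction.vonMangoldt n : ℝ) : ℂ) - 1) ≤ (1 : ℝ) :=
    LSeries.abscissaOfAbsConv_le_of_forall_lt_LSeriesSummable fun y hy => fz_summable1 (by simpa using hy)
  exact this.trans_lt (by exact_mod_cast hs)

lemma fz_summableb (k : ℕ) {s : ℂ} (hs : 1 < s.re) :
    LSeriesSummable (fun n => (fzb k n : ℂ)) s := by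
  rw [← fz_logMul]
  refine LSeriesSummable_of_abscissaOfAbsConv_lt_re ?_
  rw [LSeries.absicssaOfAbsConv_logPowMul]
  exact fz_absc hs

lemma fz_LSeriesb (k : ℕ) {s : ℂ} (hs : 1 < s.re) :
    ‖LSeries (fun n => (fzb k n : ℂ)) s‖ = ‖iteratedDeriv k fzH s‖ := by
  have h1 := LSeries_iteratedDeriv k (fz_absc hs)
  have h2 : iteratedDeriv k (LSeries (fun n : ℕ => ((ArithmeticFunction.vonMangoldt n : ℝ) : ℂ) - 1)) s
      = iteratedDeriv k fzH s := by
    apply Filter.EventuallyEq.iteratedDeriv_eq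
    filter_upwards [(isOpen_lt continuous_const Complex.continuous_re).mem_nhds hs] with z hz
    exact fz_LSeries1 hz
  rw [← h2, h1, fz_logMul]
  simp

lemma fz_term_cont (f : ℕ → ℂ) (n : ℕ) : Continuous (fun s => LSeries.term f s n) := by
  have h : Differentiable ℂ (fun s => LSeries.term f s n) := fun s =>
    (LSeries.hasDerivAt_term f n s).differentiableAt
  exact h.continuous

open MeasureTheory in
lemma fz_perron_term (k : ℕ) {c x : ℝ} (hc : 1 ≤ c) (hx : 0 < x) (n : ℕ) :
    ∫ ξ : ℝ, LSeries.term (fun n => (fzb k n : ℂ)) (fzs c ξ) n * ((x : ℂ) ^ (fzs c ξ) /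
      (fzs c ξ * (fzs c ξ + 1))) = if n = 0 then 0 else
        ((fzb k n * max (1 - n / x) 0 : ℝ) : ℂ) := by
  split_ifs with hn
  · subst hn; simp
  · have hn0 : (0 : ℝ) < n := by exact_mod_cast Nat.pos_of_ne_zero hn
    have hnC : (n : ℂ) ≠ 0 := by exact_mod_cast hn
    have hxC : (x : ℂ) ≠ 0 := by exact_mod_cast hx.ne'
    have key := fzK_inv hc (Real.log (x / n))
    have e : ∀ ξ : ℝ, LSeries.term (fun n => (fzb k n : ℂ)) (fzs c ξ) n * ((x : ℂ) ^ (fzs c ξ) /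
      (fzs c ξ * (fzs c ξ + 1))) = (fzb k n : ℂ) * (Complex.exp (fzs c ξ * (Real.log (x / n) : ℝ)) /
        (fzs c ξ * (fzs c ξ + 1))) := by
      intro ξ
      rw [LSeries.term_of_ne_zero hn, Complex.cpow_def_of_ne_zero hnC, Complex.cpow_def_of_ne_zero hxC,
        Real.log_div hx.ne' hn0.ne', Complex.ofReal_sub, mul_sub, Complex.exp_sub,
        Complex.ofReal_log hx.le, ← Complex.natCast_log, mul_comm (Complex.log (x : ℂ)),
        mul_comm ((Real.log n : ℝ) : ℂ)]
      ring
    simp_rw [e]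
    rw [integral_const_mul, key, Real.exp_neg, Real.exp_log (by positivity), inv_div]
    push_cast
    ring

open MeasureTheory in
lemma fz_perron (k : ℕ) : ∃ C : ℝ, 1 ≤ C ∧ ∀ x : ℝ, 3 ≤ x → ∀ N : ℕ, x ≤ N →
    |∑ n ∈ Finset.range N, fzb (k + 1) n * max (x - n) 0| ≤ C * x ^ 2 := by
  obtain ⟨C, hC1, hC⟩ := fzH_bound (k + 1)
  set J := ∫ ξ : ℝ, ((1 : ℝ) + ξ ^ 2) ^ (-(3 / 4) : ℝ) with hJ
  have hJ0 : 0 ≤ J := integral_nonneg fun ξ => by positivity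
  refine ⟨1 + C * 4 * Real.exp 1 * J, by have := Real.exp_pos 1; nlinarith [mul_nonneg (mul_nonneg (by linarith : (0:ℝ) ≤ C * 4) this.le) hJ0], fun x hx N hN => ?_⟩
  have hx0 : 0 < x := by linarith
  have hlog : 1 ≤ Real.log x := by
    rw [Real.le_log_iff_exp_le hx0]; linarith [Real.exp_one_lt_d9]
  set c := 1 + 1 / Real.log x with hc
  have hc1 : 1 < c := by have : 0 < 1 / Real.log x := by positivity
                         linarith
  have hc2 : c ≤ 2 := by
    have : 1 / Real.log x ≤ 1 := by rw [div_le_one (by linarith)]; exact hlog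
    linarith
  have hxc : x ^ c = Real.exp 1 * x := by
    rw [Real.rpow_def_of_pos hx0, hc, mul_add, mul_one, mul_one_div_cancel (by linarith), Real.exp_add,
      Real.exp_log hx0]
    ring
  set F : ℕ → ℝ → ℂ := fun n ξ => LSeries.term (fun n => (fzb (k + 1) n : ℂ)) (fzs c ξ) n *
    ((x : ℂ) ^ (fzs c ξ) / (fzs c ξ * (fzs c ξ + 1))) with hF
  have hxn : ∀ ξ, ‖(x : ℂ) ^ (fzs c ξ)‖ = x ^ c := fun ξ => by
    rw [Complex.norm_cpow_eq_rpow_re_of_pos hx0, fzs_re]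
  have htn : ∀ n ξ, ‖LSeries.term (fun n => (fzb (k + 1) n : ℂ)) (fzs c ξ) n‖ =
      ‖LSeries.term (fun n => (fzb (k + 1) n : ℂ)) (c : ℂ) n‖ := fun n ξ => by
    rw [LSeries.norm_term_eq, LSeries.norm_term_eq, fzs_re, Complex.ofReal_re]
  have hFn : ∀ n ξ, ‖F n ξ‖ = ‖LSeries.term (fun n => (fzb (k + 1) n : ℂ)) (c : ℂ) n‖ * x ^ c *
      ‖1 / (fzs c ξ * (fzs c ξ + 1))‖ := fun n ξ => by
    simp only [hF]
    rw [norm_mul, htn, norm_div, hxn, norm_div, norm_one]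
    ring
  have hcont : ∀ n, Continuous (F n) := fun n => by
    have h1 := (fz_term_cont (fun n => (fzb (k + 1) n : ℂ)) n).comp (fzs_cont c)
    have h2 : Continuous (fun ξ : ℝ => (x : ℂ) ^ (fzs c ξ) / (fzs c ξ * (fzs c ξ + 1))) := by
      have h0 := fzs_cont c
      exact Continuous.div (h0.const_cpow (Or.inl (by exact_mod_cast hx0.ne'))) (by fun_prop)
        (fzs_ne hc1.le)
    exact h1.mul h2
  have hFint : ∀ n, Integrable (F n) := fun n => by
    refine ((fz_int_ker hc1.le).norm.const_mul
      (‖LSeries.term (fun n => (fzb (k + 1) n : ℂ)) (c : ℂ) n‖ * x ^ c)).mono'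
      (hcont n).aestronglyMeasurable (Eventually.of_forall fun ξ => (hFn n ξ).le)
  have hsum : Summable (fun n => ∫ ξ, ‖F n ξ‖) := by
    simp_rw [hFn, integral_const_mul]
    refine Summable.mul_right _ (Summable.mul_right _ ?_)
    exact (fz_summableb (k + 1) (s := (c : ℂ)) (by simpa using hc1)).norm
  have hS := hasSum_integral_of_summable_integral_norm hFint hsum
  have hterm : ∀ n, ∫ ξ, F n ξ = ((fzb (k + 1) n * max (1 - n / x) 0 : ℝ) : ℂ) := fun n => by
    rw [fz_perron_term (k + 1) hc1.le hx0 n]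
    split_ifs with hn
    · subst hn; simp [fzb]
    · rfl
  simp_rw [hterm] at hS
  have hfin : HasSum (fun n : ℕ => ((fzb (k + 1) n * max (1 - n / x) 0 : ℝ) : ℂ))
      (∑ n ∈ Finset.range N, ((fzb (k + 1) n * max (1 - n / x) 0 : ℝ) : ℂ)) := by
    refine hasSum_sum_of_ne_finset_zero fun n hn => ?_
    have : x ≤ n := by
      rw [Finset.mem_range, not_lt] at hn
      exact hN.trans (by exact_mod_cast hn)
    rw [max_eq_right]
    · simp
    · rw [sub_nonpos, one_le_div hx0]; exact this
  have heq := hfin.unique hS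
  have hbound : ‖∫ ξ, ∑' n, F n ξ‖ ≤ C * 4 * x ^ c * J := by
    rw [hJ, ← integral_const_mul]
    refine norm_integral_le_of_norm_le (fz_int_maj.const_mul _) (Eventually.of_forall fun ξ => ?_)
    have e : ∑' n, F n ξ = LSeries (fun n => (fzb (k + 1) n : ℂ)) (fzs c ξ) *
        ((x : ℂ) ^ (fzs c ξ) / (fzs c ξ * (fzs c ξ + 1))) := by
      simp only [hF]
      rw [tsum_mul_right, LSeries]
    have hre : 1 < (fzs c ξ).re := by rw [fzs_re]; exact hc1
    rw [e, norm_mul, fz_LSeriesb (k + 1) hre, norm_div, hxn]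
    have h1 := hC (fzs c ξ) hre (by rw [fzs_re]; exact hc2)
    rw [fzs_im] at h1
    have hq : (0 : ℝ) < 1 + ξ ^ 2 := by positivity
    have h2 : (4 + |2 * π * ξ|) ^ (1 / 2 : ℝ) ≤ 4 * (1 + ξ ^ 2) ^ (1 / 4 : ℝ) := by
      have a1 : 4 + |2 * π * ξ| ≤ 16 * (1 + ξ ^ 2) ^ (1 / 2 : ℝ) := by
        rw [← Real.sqrt_eq_rpow]
        have : 4 + |2 * π * ξ| ≤ 16 * Real.sqrt (1 + ξ ^ 2) := by
          have b1 : |ξ| ≤ Real.sqrt (1 + ξ ^ 2) := Real.abs_le_sqrt (by linarith)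
          have b2 : 1 ≤ Real.sqrt (1 + ξ ^ 2) := Real.one_le_sqrt.2 (by nlinarith [sq_nonneg ξ])
          rw [abs_mul, abs_of_pos (by positivity)]
          have b3 := Real.pi_lt_four
          have : 2 * π * |ξ| ≤ 8 * |ξ| := by
            have := abs_nonneg ξ
            nlinarith
          linarith
        exact this
      calc (4 + |2 * π * ξ|) ^ (1 / 2 : ℝ) ≤ (16 * (1 + ξ ^ 2) ^ (1 / 2 : ℝ)) ^ (1 / 2 : ℝ) := by
            gcongr
        _ = 4 * (1 + ξ ^ 2) ^ (1 / 4 : ℝ) := by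
            rw [Real.mul_rpow (by norm_num) (by positivity), ← Real.rpow_mul hq.le,
              show (16 : ℝ) = 4 ^ (2 : ℝ) by norm_num, ← Real.rpow_mul (by norm_num)]
            norm_num
    have h3 := fzs_norm hc1.le ξ
    calc ‖iteratedDeriv (k + 1) fzH (fzs c ξ)‖ * (x ^ c / ‖fzs c ξ * (fzs c ξ + 1)‖)
        ≤ (C * (4 * (1 + ξ ^ 2) ^ (1 / 4 : ℝ))) * (x ^ c / (1 + ξ ^ 2)) := by
          gcongr
          exact h1.trans (by gcongr)
      _ = C * 4 * x ^ c * ((1 + ξ ^ 2) ^ (1 / 4 : ℝ) / (1 + ξ ^ 2)) := by ring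
      _ = C * 4 * x ^ c * (1 + ξ ^ 2) ^ (-(3 / 4) : ℝ) := by
          congr 1
          rw [← Real.rpow_sub_one hq.ne']
          norm_num
  rw [← heq, ← Complex.ofReal_sum, Complex.norm_real, Real.norm_eq_abs, hxc] at hbound
  have e2 : ∑ n ∈ Finset.range N, fzb (k + 1) n * max (x - n) 0 =
      x * ∑ n ∈ Finset.range N, fzb (k + 1) n * max (1 - n / x) 0 := by
    rw [Finset.mul_sum]
    refine Finset.sum_congr rfl fun n _ => ?_
    have : max (x - n) 0 = x * max (1 - n / x) 0 := by
      rw [mul_max_of_nonneg _ _ hx0.le, mul_zero]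
      congr 1
      field_simp
    rw [this]; ring
  rw [e2, abs_mul, abs_of_pos hx0]
  nlinarith [mul_le_mul_of_nonneg_left hbound hx0.le]

noncomputable def fzB (N : ℕ) : ℝ := ∑ n ∈ Finset.range (N + 1), fzb 6 n

lemma fzb_ge (k n : ℕ) : -(Real.log n) ^ k ≤ fzb k n := by
  have h0 : 0 ≤ Real.log n := Real.log_natCast_nonneg n
  have h1 : 0 ≤ ArithmeticFunction.vonMangoldt n := ArithmeticFunction.vonMangoldt_nonneg
  have h2 : 0 ≤ (Real.log n) ^ k := by positivity
  unfold fzb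
  nlinarith [mul_nonneg h1 h2]

lemma fz_log3 {x : ℝ} (hx : 1 ≤ x) : (Real.log x) ^ 3 ≤ 6 * x := by
  have h := Real.pow_div_factorial_le_exp (x := Real.log x) (Real.log_nonneg hx) 3
  rw [Real.exp_log (by linarith)] at h
  have : ((Nat.factorial 3 : ℕ) : ℝ) = 6 := by norm_num [Nat.factorial]
  rw [this, div_le_iff₀ (by norm_num)] at h
  linarith

lemma fzB_lower_large : ∃ C : ℝ, 1 ≤ C ∧ ∀ N : ℕ, 8 ≤ N →
    -(C * (N * (Real.log N) ^ 3)) ≤ fzB N := by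
  obtain ⟨C, hC1, hC⟩ := fz_perron 5
  refine ⟨2 * C + 13, by linarith, fun N hN => ?_⟩
  have hx8 : (8 : ℝ) ≤ N := by exact_mod_cast hN
  set x : ℝ := (N : ℝ) with hx
  have hx0 : 0 < x := by linarith
  set L := Real.log x with hL
  have hL2 : 2 ≤ L := by
    rw [hL, Real.le_log_iff_exp_le hx0]
    have e : Real.exp 2 = Real.exp 1 * Real.exp 1 := by rw [← Real.exp_add]; norm_num
    rw [e]
    nlinarith [Real.exp_one_lt_d9, Real.exp_pos 1]
  have hL8 : 8 ≤ L ^ 3 := by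
    have := pow_le_pow_left₀ (by norm_num : (0:ℝ) ≤ 2) hL2 3
    linarith
  have hL0 : 0 < L := by linarith
  set h := x / L ^ 3 with hh
  have hh0 : 0 < h := by positivity
  have hhx : h * L ^ 3 = x := by rw [hh]; field_simp
  have hh8 : 8 * h ≤ x := by nlinarith
  have p1 := hC x (by linarith) N le_rfl
  have p2 := hC (x - h) (by linarith) N (by rw [← hx]; linarith)
  norm_num at p1 p2
  set m : ℕ → ℝ := fun n => max (x - n) 0 - max (x - h - n) 0 with hm
  have m0 : ∀ n, 0 ≤ m n := fun n => by
    simp only [hm]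
    have : max (x - h - n) 0 ≤ max (x - n) 0 := max_le_max (by linarith) le_rfl
    linarith
  have mh : ∀ n, m n ≤ h := fun n => by
    simp only [hm]
    have : max (x - n) 0 ≤ max (x - h - n) 0 + h := by
      apply max_le
      · have := le_max_left (x - h - n) 0
        linarith
      · have := le_max_right (x - h - n) 0
        linarith
    linarith
  have meq : ∀ n : ℕ, (n : ℝ) ≤ x - h → m n = h := fun n hn => by
    simp only [hm]
    rw [max_eq_left (by linarith), max_eq_left (by linarith)]
    ring
  have hdiff : |∑ n ∈ Finset.range N, fzb 6 n * m n| ≤ 2 * C * x ^ 2 := by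
    have e : ∑ n ∈ Finset.range N, fzb 6 n * m n =
        ∑ n ∈ Finset.range N, fzb 6 n * max (x - n) 0 -
        ∑ n ∈ Finset.range N, fzb 6 n * max (x - h - n) 0 := by
      rw [← Finset.sum_sub_distrib]
      refine Finset.sum_congr rfl fun n _ => ?_
      simp only [hm]; ring
    rw [e]
    refine (abs_sub _ _).trans ?_
    have : (x - h) ^ 2 ≤ x ^ 2 := by
      apply pow_le_pow_left₀ <;> linarith
    nlinarith
  have hcard : ∑ n ∈ Finset.range N, (h - m n) ≤ h * (h + 1) := by
    have h1 : ∀ n ∈ Finset.range N, h - m n ≤ if x - h < (n : ℝ) then h else 0 := fun n _ => by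
      split_ifs with q
      · linarith [m0 n]
      · rw [meq n (not_lt.1 q)]; simp
    refine (Finset.sum_le_sum h1).trans ?_
    rw [← Finset.sum_filter, Finset.sum_const, nsmul_eq_mul, mul_comm]
    apply mul_le_mul_of_nonneg_left _ hh0.le
    have h2 : (Finset.range N).filter (fun n : ℕ => x - h < (n : ℝ)) ⊆
        Finset.Ico ⌊x - h⌋₊ N := by
      intro n hn
      rw [Finset.mem_filter, Finset.mem_range] at hn
      rw [Finset.mem_Ico]
      exact ⟨Nat.floor_le_of_le hn.2.le, hn.1⟩
    have h3 := Finset.card_le_card h2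
    rw [Nat.card_Ico] at h3
    have h4 : ⌊x - h⌋₊ ≤ N := Nat.floor_le_of_le (by rw [← hx]; linarith)
    have h5 : x - h < ⌊x - h⌋₊ + 1 := Nat.lt_floor_add_one _
    have h6 : (((Finset.range N).filter (fun n : ℕ => x - h < (n : ℝ))).card : ℝ) ≤
        x - ⌊x - h⌋₊ := by
      rw [hx, ← Nat.cast_sub h4]
      exact_mod_cast h3
    linarith
  have hlow : -(L ^ 6 * (h * (h + 1))) ≤ ∑ n ∈ Finset.range N, fzb 6 n * (h - m n) := by
    have h1 : ∀ n ∈ Finset.range N, -(L ^ 6) * (h - m n) ≤ fzb 6 n * (h - m n) := fun n hn => by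
      apply mul_le_mul_of_nonneg_right _ (by linarith [mh n])
      refine le_trans ?_ (fzb_ge 6 n)
      rw [neg_le_neg_iff]
      rcases Nat.eq_zero_or_pos n with rfl | hn0
      · simp; positivity
      · have : Real.log n ≤ L := by
          rw [hL, hx]
          apply Real.log_le_log (by exact_mod_cast hn0)
          exact_mod_cast (Finset.mem_range.1 hn).le
        exact pow_le_pow_left₀ (Real.log_natCast_nonneg n) this 6
    have h2 := Finset.sum_le_sum h1
    rw [← Finset.mul_sum] at h2
    have h3 : (0:ℝ) ≤ L ^ 6 := by positivity
    nlinarith [mul_le_mul_of_nonneg_left hcard h3]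
  have hsum : h * ∑ n ∈ Finset.range N, fzb 6 n = ∑ n ∈ Finset.range N, fzb 6 n * (h - m n) +
      ∑ n ∈ Finset.range N, fzb 6 n * m n := by
    rw [← Finset.sum_add_distrib, Finset.mul_sum]
    refine Finset.sum_congr rfl fun n _ => ?_
    ring
  have hfin : -(L ^ 6 * (h + 1)) - 2 * C * x * L ^ 3 ≤ ∑ n ∈ Finset.range N, fzb 6 n := by
    have := (abs_le.1 hdiff).1
    refine le_of_mul_le_mul_left ?_ hh0
    rw [hsum]
    have e : h * (-(L ^ 6 * (h + 1)) - 2 * C * x * L ^ 3) =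
      -(L ^ 6 * (h * (h + 1))) - 2 * C * x * (h * L ^ 3) := by ring
    rw [e, hhx]
    nlinarith
  have hl3 : L ^ 3 ≤ 6 * x := fz_log3 (by linarith)
  have hl6 : L ^ 6 ≤ 6 * (x * L ^ 3) := by
    have : L ^ 6 = L ^ 3 * L ^ 3 := by ring
    rw [this]
    nlinarith
  have hl6h : L ^ 6 * h = x * L ^ 3 := by
    have : L ^ 6 * h = (h * L ^ 3) * L ^ 3 := by ring
    rw [this, hhx]
  have hlast := fzb_ge 6 N
  rw [← hx, ← hL] at hlast
  unfold fzB
  rw [Finset.sum_range_succ]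
  nlinarith

lemma fzB_lower : ∃ C : ℝ, 1 ≤ C ∧ ∀ N : ℕ, 1 ≤ N →
    -(C * (N * (Real.log N) ^ 3)) ≤ fzB N := by
  obtain ⟨C, hC1, hC⟩ := fzB_lower_large
  refine ⟨C + 96, by linarith, fun N hN => ?_⟩
  have h0 : (0:ℝ) ≤ N * (Real.log N) ^ 3 := by
    have := Real.log_natCast_nonneg N
    positivity
  have hN1 : (1:ℝ) ≤ N := by exact_mod_cast hN
  by_cases h8 : 8 ≤ N
  · have := hC N h8
    nlinarith
  · have h1 : ∀ n ∈ Finset.range (N + 1), -(Real.log N) ^ 6 ≤ fzb 6 n := fun n hn => by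
      refine le_trans ?_ (fzb_ge 6 n)
      rw [neg_le_neg_iff]
      rcases Nat.eq_zero_or_pos n with rfl | hn0
      · simp
        have := Real.log_natCast_nonneg N
        positivity
      · have : Real.log n ≤ Real.log N := by
          apply Real.log_le_log (by exact_mod_cast hn0)
          exact_mod_cast Nat.lt_succ_iff.1 (Finset.mem_range.1 hn)
        exact pow_le_pow_left₀ (Real.log_natCast_nonneg n) this 6
    have h2 := Finset.sum_le_sum h1
    rw [Finset.sum_const, Finset.card_range, nsmul_eq_mul] at h2
    push_cast at h2
    have h3 := fz_log3 hN1
    have h4 : (N:ℝ) ≤ 8 := by exact_mod_cast (not_le.1 h8).le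
    have h5 : (Real.log N) ^ 6 ≤ 48 * (Real.log N) ^ 3 := by
      have e : (Real.log N) ^ 6 = (Real.log N) ^ 3 * (Real.log N) ^ 3 := by ring
      have := Real.log_natCast_nonneg N
      rw [e]
      apply mul_le_mul_of_nonneg_right (by linarith) (by positivity)
    have h6 : ((N:ℝ) + 1) * (Real.log N) ^ 6 ≤ 2 * N * (48 * (Real.log N) ^ 3) := by
      have := Real.log_natCast_nonneg N
      apply mul_le_mul (by linarith) h5 (by positivity) (by positivity)
    unfold fzB
    nlinarith

noncomputable def fzA (N : ℕ) : ℝ :=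
  ∑ n ∈ Finset.range (N + 1), (ArithmeticFunction.vonMangoldt n - 1) / Real.log n

lemma fz_w {a b : ℝ} (ha : 0 < a) (hab : a ≤ b) : 1 / a ^ 7 - 1 / b ^ 7 ≤ 7 * (b - a) / a ^ 8 := by
  have hb : 0 < b := by linarith
  have h1 := one_add_mul_le_pow (a := a / b - 1) (by have : 0 < a / b := by positivity
                                                     linarith) 7
  have h2 : 1 - a / b ≤ (b - a) / a := by
    rw [← sub_nonneg]
    have : (b - a) / a - (1 - a / b) = (b - a) ^ 2 / (a * b) := by field_simp
    rw [this]; positivity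
  have h3 : 1 - (a / b) ^ 7 ≤ 7 * ((b - a) / a) := by
    rw [show 1 + (a / b - 1) = a / b by ring] at h1
    push_cast at h1
    linarith
  have e1 : 1 / a ^ 7 - 1 / b ^ 7 = (1 - (a / b) ^ 7) / a ^ 7 := by field_simp
  have e2 : 7 * (b - a) / a ^ 8 = (7 * ((b - a) / a)) / a ^ 7 := by field_simp
  rw [e1, e2]
  gcongr

lemma fzA_lower : ∃ C : ℝ, 1 ≤ C ∧ ∀ N : ℕ, 2 ≤ N →
    -(C * (N / (Real.log N) ^ 4)) - C * ∑ n ∈ Finset.range N, 1 / (Real.log n) ^ 5 ≤ fzA N := by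
  obtain ⟨C, hC1, hC⟩ := fzB_lower
  have key : ∀ N : ℕ, 2 ≤ N → fzB N * (1 / (Real.log N) ^ 7) -
      7 * C * ∑ n ∈ Finset.range N, 1 / (Real.log n) ^ 5 ≤ fzA N := by
    intro N hN
    induction N, hN using Nat.le_induction with
    | base =>
      have : (0:ℝ) < Real.log 2 := Real.log_pos (by norm_num)
      simp [fzB, fzA, Finset.sum_range_succ, fzb]
      apply le_of_eq
      field_simp
    | succ N hN ih =>
      have hN0 : (0:ℝ) < N := by exact_mod_cast (by omega : 0 < N)
      have ha : 0 < Real.log N := Real.log_pos (by exact_mod_cast (by omega : 1 < N))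
      have hab : Real.log N ≤ Real.log ((N + 1 : ℕ) : ℝ) :=
        Real.log_le_log hN0 (by push_cast; linarith)
      have hba : Real.log ((N + 1 : ℕ) : ℝ) - Real.log N ≤ 1 / N := by
        rw [← Real.log_div (by positivity) hN0.ne']
        refine (Real.log_le_sub_one_of_pos (by positivity)).trans ?_
        push_cast
        apply le_of_eq; field_simp; ring
      have hw := fz_w ha hab
      have hw0 : 0 ≤ 1 / (Real.log N) ^ 7 - 1 / (Real.log ((N + 1 : ℕ) : ℝ)) ^ 7 := by
        rw [sub_nonneg]
        gcongr
      set a := Real.log N with ha'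
      set b := Real.log ((N + 1 : ℕ) : ℝ) with hb'
      have hb0 : 0 < b := by linarith
      have hB := hC N (by omega)
      rw [← ha'] at hB
      have h1 : -(7 * C * (1 / a ^ 5)) ≤ fzB N * (1 / a ^ 7 - 1 / b ^ 7) := by
        have h2 : -(C * (N * a ^ 3)) * (1 / a ^ 7 - 1 / b ^ 7) ≤ fzB N * (1 / a ^ 7 - 1 / b ^ 7) :=
          mul_le_mul_of_nonneg_right hB hw0
        have h3 : (C * (N * a ^ 3)) * (1 / a ^ 7 - 1 / b ^ 7) ≤
            (C * (N * a ^ 3)) * (7 * (1 / N) / a ^ 8) := by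
          apply mul_le_mul_of_nonneg_left _ (by positivity)
          refine hw.trans ?_
          gcongr
        have h4 : (C * (N * a ^ 3)) * (7 * (1 / N) / a ^ 8) = 7 * C * (1 / a ^ 5) := by
          field_simp
        linarith
      have eA : fzA (N + 1) = fzA N + fzb 6 (N + 1) * (1 / b ^ 7) := by
        unfold fzA
        rw [Finset.sum_range_succ _ (N + 1)]
        congr 1
        unfold fzb
        rw [← hb']
        field_simp
      have eB : fzB (N + 1) = fzB N + fzb 6 (N + 1) := by
        unfold fzB
        rw [Finset.sum_range_succ _ (N + 1)]
      rw [eA, eB, Finset.sum_range_succ, ← ha']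
      nlinarith
  refine ⟨7 * C, by linarith, fun N hN => le_trans ?_ (key N hN)⟩
  have ha : 0 < Real.log N := Real.log_pos (by exact_mod_cast (by omega : 1 < N))
  have h1 := mul_le_mul_of_nonneg_right (hC N (by omega))
    (by positivity : 0 ≤ 1 / (Real.log N) ^ 7)
  have h2 : -(C * (N * Real.log N ^ 3)) * (1 / Real.log N ^ 7) = -(C * (N / Real.log N ^ 4)) := by
    field_simp
  have h3 : 0 ≤ C * (N / Real.log N ^ 4) := by positivity
  linarith

lemma fz_pi_ge {N : ℕ} (hN : 1 ≤ N) :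
    fzA N + ∑ n ∈ Finset.range (N + 1), 1 / Real.log n - 3 * (√(N : ℝ) * Real.log N) ≤
      (Nat.primeCounting N : ℝ) := by
  have hl2 := Real.log_two_gt_d9
  have h1 := Chebyshev.psi_sub_theta_le (x := (N : ℝ)) (by exact_mod_cast hN)
  rw [Chebyshev.psi_sub_theta_eq_sum_not_prime, Nat.floor_natCast] at h1
  have e1 : fzA N + ∑ n ∈ Finset.range (N + 1), 1 / Real.log n =
      ∑ n ∈ Finset.Ioc 0 N, ArithmeticFunction.vonMangoldt n / Real.log n := by
    unfold fzA
    rw [← Finset.sum_add_distrib]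
    symm
    have hs : Finset.Ioc 0 N ⊆ Finset.range (N + 1) := by
      intro n hn
      rw [Finset.mem_Ioc] at hn
      rw [Finset.mem_range]; omega
    rw [← Finset.sum_subset hs]
    · refine Finset.sum_congr rfl fun n _ => ?_
      ring
    · intro n hn hn'
      rw [Finset.mem_Ioc] at hn'
      rw [Finset.mem_range] at hn
      have : n = 0 := by omega
      subst this; simp
  rw [e1, ← Finset.sum_filter_add_sum_filter_not _ Nat.Prime]
  have e2 : ∑ n ∈ Finset.Ioc 0 N with Nat.Prime n, ArithmeticFunction.vonMangoldt n / Real.log n =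
      (Nat.primeCounting N : ℝ) := by
    rw [← Nat.primesLE_card_eq_primeCounting, Nat.primesLE_eq_filter_Ioc_zero, Finset.card_eq_sum_ones,
      Nat.cast_sum]
    refine Finset.sum_congr rfl fun n hn => ?_
    rw [Finset.mem_filter] at hn
    rw [ArithmeticFunction.vonMangoldt_apply_prime hn.2, div_self, Nat.cast_one]
    exact (Real.log_pos (by exact_mod_cast hn.2.one_lt)).ne'
  have e3 : ∑ n ∈ Finset.Ioc 0 N with ¬ Nat.Prime n, ArithmeticFunction.vonMangoldt n / Real.log n ≤
      3 / 2 * ∑ n ∈ Finset.Ioc 0 N with ¬ Nat.Prime n, ArithmeticFunction.vonMangoldt n := by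
    rw [Finset.mul_sum]
    refine Finset.sum_le_sum fun n hn => ?_
    have hv : 0 ≤ ArithmeticFunction.vonMangoldt n := ArithmeticFunction.vonMangoldt_nonneg
    rw [Finset.mem_filter, Finset.mem_Ioc] at hn
    rcases Nat.lt_or_ge n 2 with h | h
    · have : n = 1 := by omega
      subst this; simp
    · have : Real.log 2 ≤ Real.log n := Real.log_le_log (by norm_num) (by exact_mod_cast h)
      rw [div_le_iff₀ (by linarith)]
      nlinarith
  rw [e2]
  nlinarith

noncomputable def fzM (x : ℝ) : ℝ :=
  x / Real.log x + x / (Real.log x) ^ 2 + 3 / 5 * (x / (Real.log x) ^ 3)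

lemma fzM_deriv {x : ℝ} (hx : 1 < x) : HasDerivAt fzM (1 / Real.log x - 7 / 5 / (Real.log x) ^ 3 -
    9 / 5 / (Real.log x) ^ 4) x := by
  have hl : 0 < Real.log x := Real.log_pos hx
  have hx0 : x ≠ 0 := by linarith
  have d := Real.hasDerivAt_log hx0
  have d1 := (hasDerivAt_id x).div d hl.ne'
  have d2 := (hasDerivAt_id x).div (d.pow 2) (by simp; exact ⟨hx0, by constructor <;> linarith⟩)
  have d3 := ((hasDerivAt_id x).div (d.pow 3) (pow_ne_zero 3 hl.ne')).const_mul (3 / 5)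
  have := (d1.add d2).add d3
  refine this.congr_deriv ?_
  simp
  field_simp
  ring

lemma fzM_step (C : ℝ) (hC : 1 ≤ C) : ∃ n0 : ℕ, 2 ≤ n0 ∧ ∀ n : ℕ, n0 ≤ n →
    fzM ((n + 1 : ℕ) : ℝ) - fzM n ≤ 1 / Real.log n - C * (1 / (Real.log n) ^ 5) := by
  have ht : Tendsto (fun n : ℕ => Real.log n) atTop atTop :=
    Real.tendsto_log_atTop.comp tendsto_natCast_atTop_atTop
  obtain ⟨n1, hn1⟩ := eventually_atTop.1 (ht.eventually_ge_atTop (8 * C))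
  refine ⟨max 2 n1, le_max_left _ _, fun n hn => ?_⟩
  have h2 : 2 ≤ n := (le_max_left _ _).trans hn
  have hL : 8 * C ≤ Real.log n := hn1 n ((le_max_right _ _).trans hn)
  have hn1' : (1 : ℝ) < n := by exact_mod_cast (by omega : 1 < n)
  have hlt : (n : ℝ) < ((n + 1 : ℕ) : ℝ) := by push_cast; linarith
  obtain ⟨y, hy, hy'⟩ := exists_hasDerivAt_eq_slope fzM _ hlt
    (fun x hx => (fzM_deriv (by linarith [hx.1])).continuousAt.continuousWithinAt)
    (fun x hx => fzM_deriv (by linarith [hx.1]))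
  have e : ((n + 1 : ℕ) : ℝ) - n = 1 := by push_cast; ring
  rw [e, div_one] at hy'
  rw [← hy']
  set a := Real.log n
  set b := Real.log y with hb
  have ha0 : 0 < a := by linarith
  have hab : a ≤ b := Real.log_le_log (by linarith) hy.1.le
  have hb0 : 0 < b := by linarith
  have hba : b ≤ 2 * a := by
    have : b ≤ Real.log ((n : ℝ) ^ 2) := by
      apply Real.log_le_log (by linarith [hy.1])
      have h3 := hy.2
      push_cast at h3
      have : (2:ℝ) ≤ n := by exact_mod_cast h2
      nlinarith
    rw [Real.log_pow] at this
    exact_mod_cast this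
  have k1 : 1 / b ≤ 1 / a := by gcongr
  have k2 : 0 ≤ 9 / 5 / b ^ 4 := by positivity
  have k3 : C * (1 / a ^ 5) ≤ 7 / 5 / b ^ 3 := by
    have : 7 / 5 / (2 * a) ^ 3 ≤ 7 / 5 / b ^ 3 := by gcongr
    refine le_trans ?_ this
    rw [mul_one_div, div_div, div_le_div_iff₀ (by positivity) (by positivity)]
    have : 8 * C ≤ a ^ 2 := by nlinarith
    have h3 : 0 < a ^ 3 := by positivity
    have e : a ^ 5 = a ^ 2 * a ^ 3 := by ring
    rw [e]
    nlinarith [mul_le_mul_of_nonneg_right this h3.le]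
  linarith

lemma fz_pi_lower0 : ∃ C K : ℝ, ∃ n0 : ℕ, 2 ≤ n0 ∧ ∀ N : ℕ, n0 ≤ N →
    fzM N - K - C * (N / (Real.log N) ^ 4) - 3 * (√(N : ℝ) * Real.log N) ≤
      (Nat.primeCounting N : ℝ) := by
  obtain ⟨C, hC1, hC⟩ := fzA_lower
  obtain ⟨n0, h2, hstep⟩ := fzM_step C hC1
  set S : ℕ → ℝ := fun N => ∑ n ∈ Finset.range N, (1 / Real.log n - C * (1 / (Real.log n) ^ 5)) with hS
  have hmain : ∀ N : ℕ, n0 ≤ N → fzM N - (fzM n0 - S n0) ≤ S N := by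
    intro N hN
    induction N, hN using Nat.le_induction with
    | base => linarith
    | succ N hN ih =>
      have := hstep N hN
      have e : S (N + 1) = S N + (1 / Real.log N - C * (1 / (Real.log N) ^ 5)) := by
        simp only [hS]; rw [Finset.sum_range_succ]
      rw [e]; linarith
  refine ⟨C, fzM n0 - S n0, n0, h2, fun N hN => ?_⟩
  have k1 := hmain N hN
  have k2 := hC N (h2.trans hN)
  have k3 := fz_pi_ge (N := N) (by omega)
  rw [Finset.sum_range_succ] at k3
  have k4 : 0 ≤ 1 / Real.log N := by
    have := Real.log_natCast_nonneg N
    positivity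
  have eS : S N = ∑ n ∈ Finset.range N, 1 / Real.log n -
      C * ∑ n ∈ Finset.range N, 1 / (Real.log n) ^ 5 := by
    simp only [hS, Finset.sum_sub_distrib, ← Finset.mul_sum]
  rw [eS] at k1
  linarith

lemma fz_pi_lower : ∀ᶠ N : ℕ in atTop,
    (N : ℝ) / Real.log N * (1 + 1 / Real.log N + 1 / (2 * (Real.log N) ^ 2)) ≤
      (Nat.primeCounting N : ℝ) := by
  obtain ⟨C, K, n0, h2, h⟩ := fz_pi_lower0
  have hcast : Tendsto (fun n : ℕ => (n : ℝ)) atTop atTop := tendsto_natCast_atTop_atTop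
  have ht : Tendsto (fun n : ℕ => Real.log n) atTop atTop := Real.tendsto_log_atTop.comp hcast
  have hsq : Tendsto (fun n : ℕ => √(n : ℝ)) atTop atTop := Real.tendsto_sqrt_atTop.comp hcast
  have o1 := hcast.eventually ((isLittleO_pow_log_id_atTop (n := 3)).bound
    (show (0:ℝ) < 1 / (30 * (|K| + 1)) by positivity))
  have o2 := hsq.eventually ((isLittleO_pow_log_id_atTop (n := 4)).bound
    (show (0:ℝ) < 1 / 1440 by norm_num))
  filter_upwards [o1, o2, ht.eventually_ge_atTop (30 * (|C| + 1)), eventually_ge_atTop n0] with N a1 a2 a3 a4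
  have hN := h N a4
  have hN0 : (0:ℝ) < N := by exact_mod_cast (by omega : 0 < N)
  have hs0 : 0 < √(N:ℝ) := Real.sqrt_pos.2 hN0
  have hss : √(N:ℝ) * √(N:ℝ) = N := Real.mul_self_sqrt hN0.le
  have hls : Real.log √(N:ℝ) = Real.log N / 2 := Real.log_sqrt hN0.le
  simp only [hls] at a2
  set L := Real.log N with hL
  set s := √(N:ℝ) with hs
  have hL0 : 0 < L := by have := abs_nonneg C; linarith
  simp only [id, Real.norm_eq_abs, abs_of_pos hN0, abs_of_pos hs0] at a1 a2
  rw [abs_of_pos (by positivity)] at a1 a2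
  have b1 : K * L ^ 3 ≤ N / 30 := by
    rw [one_div, ← div_eq_inv_mul, le_div_iff₀ (by positivity)] at a1
    have h3 : 0 < L ^ 3 := by positivity
    nlinarith [mul_le_mul_of_nonneg_right (le_abs_self K) h3.le]
  have b2 : 3 * (s * L) * L ^ 3 ≤ N / 30 := by
    have : L ^ 4 ≤ s / 90 := by
      have e : (L / 2) ^ 4 = L ^ 4 / 16 := by ring
      rw [e] at a2; linarith
    nlinarith [mul_le_mul_of_nonneg_left this hs0.le]
  have b3 : C * (N / L ^ 4) * L ^ 3 ≤ N / 30 := by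
    have e : C * (N / L ^ 4) * L ^ 3 = C / L * N := by field_simp
    rw [e]
    have : C / L ≤ 1 / 30 := by
      rw [div_le_iff₀ hL0]
      linarith [le_abs_self C]
    nlinarith
  refine le_trans ?_ hN
  have b4 : (K + 3 * (s * L) + C * (N / L ^ 4)) ≤ (N / 10) / L ^ 3 := by
    rw [le_div_iff₀ (by positivity)]
    linarith
  have e : fzM N = N / L * (1 + 1 / L + 1 / (2 * L ^ 2)) + (N / 10) / L ^ 3 := by
    unfold fzM
    rw [← hL]
    field_simp
    ring
  linarith

theorem stmt_0
    (h : ∀ᶠ n : ℕ in atTop,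
      (p n : ℝ) ^ ((1 : ℝ) / n) > (p (n + 1) : ℝ) ^ ((1 : ℝ) / (n + 1))) :
    ∃ N : ℕ, ∀ n > N,
      (p (n + 1) : ℝ) - p n < (Real.log (p n)) ^ 2 - Real.log (p n) + 1 := by
  have hpn : ∀ n : ℕ, n + 1 ≤ p n := fun n => by
    have := Nat.add_two_le_nth_prime (n - 1)
    unfold p; omega
  have hpt : Tendsto p atTop atTop :=
    tendsto_atTop_mono (fun n => (Nat.le_succ n).trans (hpn n)) tendsto_id
  have hcount : ∀ n : ℕ, 1 ≤ n → Nat.primeCounting (p n) = n := fun n hn => by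
    have h1 : Nat.primeCounting' (p n) = n - 1 := Nat.primeCounting'_nth_eq (n - 1)
    have h2 : Nat.Prime (p n) := Nat.prime_nth_prime (n - 1)
    rw [Nat.primeCounting_eq_primeCounting'_succ]
    unfold Nat.primeCounting' at h1 ⊢
    rw [Nat.count_succ, h1, if_pos h2]
    omega
  have hpl : Tendsto (fun n => (p n : ℝ)) atTop atTop := tendsto_natCast_atTop_atTop.comp hpt
  have hLt : Tendsto (fun n => Real.log (p n)) atTop atTop := Real.tendsto_log_atTop.comp hpl
  have o1 := hpl.eventually ((isLittleO_pow_log_id_atTop (n := 4)).bound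
    (show (0:ℝ) < 1 / 4 by norm_num))
  have key : ∀ᶠ n : ℕ in atTop,
      (p (n + 1) : ℝ) - p n < (Real.log (p n)) ^ 2 - Real.log (p n) + 1 := by
    filter_upwards [h, hpt.eventually fz_pi_lower, hLt.eventually_ge_atTop 2, o1,
      eventually_ge_atTop 1] with n hF hpi hL2 ho hn1
    rw [hcount n hn1] at hpi
    have hn0 : (0:ℝ) < n := by exact_mod_cast hn1
    have hP0 : (0:ℝ) < p n := by exact_mod_cast (by have := hpn n; omega : 0 < p n)
    have hQ0 : (0:ℝ) < p (n + 1) := by exact_mod_cast (by have := hpn (n + 1); omega : 0 < p (n + 1))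
    set P : ℝ := (p n : ℝ) with hP
    set Q : ℝ := (p (n + 1) : ℝ) with hQ
    set L := Real.log P with hL
    set m : ℝ := (n : ℝ) with hm
    have hL0 : 0 < L := by linarith
    -- the counting bound
    have c1 : P ≤ m * (L - 1 + 1 / (2 * L)) := by
      have hpos : 0 < L - 1 + 1 / (2 * L) := by
        have : 0 < 1 / (2 * L) := by positivity
        linarith
      refine le_trans ?_ (mul_le_mul_of_nonneg_right hpi hpos.le)
      have e : P / L * (1 + 1 / L + 1 / (2 * L ^ 2)) * (L - 1 + 1 / (2 * L)) =
          P + P / (4 * L ^ 4) := by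
        field_simp
        ring
      rw [e]
      have : 0 ≤ P / (4 * L ^ 4) := by positivity
      linarith
    have c2 : P ≤ m * L := by
      have : 1 / (2 * L) ≤ 1 := by rw [div_le_one (by positivity)]; linarith
      nlinarith
    simp only [id, Real.norm_eq_abs, abs_of_pos hP0] at ho
    rw [abs_of_pos (by positivity)] at ho
    have c3 : L ^ 3 ≤ m / 4 := by
      have : L * L ^ 3 ≤ L * (m / 4) := by
        have e : L * L ^ 3 = L ^ 4 := by ring
        rw [e]; linarith
      exact le_of_mul_le_mul_left this hL0
    -- Firoozbakht
    have hlog : Real.log Q < L + L / m := by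
      have := Real.log_lt_log (by positivity) hF
      rw [Real.log_rpow hQ0, Real.log_rpow hP0, ← hL] at this
      have hm1 : 0 < m + 1 := by linarith
      have e1 : 1 / (m + 1) * Real.log Q = Real.log Q / (m + 1) := by ring
      rw [e1, div_lt_iff₀ hm1] at this
      have e2 : 1 / m * L * (m + 1) = L + L / m := by field_simp
      linarith
    have hQ' : Q < P * Real.exp (L / m) := by
      have := Real.exp_lt_exp.2 hlog
      rwa [Real.exp_log hQ0, Real.exp_add, hL, Real.exp_log hP0, ← hL] at this
    have hu0 : 0 ≤ L / m := by positivity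
    have hu1 : L / m ≤ 1 := by
      rw [div_le_one hn0]
      have : L ≤ L ^ 3 := by nlinarith [mul_pos hL0 hL0]
      linarith
    have hexp : Real.exp (L / m) ≤ 1 + L / m + (L / m) ^ 2 := by
      have := Real.abs_exp_sub_one_sub_id_le (x := L / m) (by rw [abs_of_nonneg hu0]; exact hu1)
      have := (abs_le.1 this).2
      linarith
    have hA : P * (L / m) ≤ L ^ 2 - L + 1 / 2 := by
      have e : m * (L - 1 + 1 / (2 * L)) * (L / m) = L ^ 2 - L + 1 / 2 := by field_simp
      rw [← e]
      exact mul_le_mul_of_nonneg_right c1 hu0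
    have hB : P * (L / m) ^ 2 ≤ 1 / 4 := by
      have e : m * L * (L / m) ^ 2 = L ^ 3 / m := by field_simp
      refine (mul_le_mul_of_nonneg_right c2 (by positivity)).trans ?_
      rw [e, div_le_iff₀ hn0]
      linarith
    have := mul_le_mul_of_nonneg_left hexp hP0.le
    nlinarith
  obtain ⟨N, hN⟩ := eventually_atTop.1 key
  exact ⟨N, fun n hn => hN n hn.le⟩
end

section
/- If there exists a positive constant c_0 such that p_n^(1/n) > (1 - c_0 ln p_n / n^2) * p_{n+1}^(1/(n+1)) for all sufficiently large n, then there exists N such that for all n > N, p_{n+1} - p_n < (1 + c_0)((ln p_n)^2 - ln p_n) + 1. -/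
open Filter Real

namespace PNT
open Complex Set MeasureTheory Topology ZetaAsymptotics

/-- Terms of the continuation of `(s-1) ζ(s) - 1`. -/
noncomputable def gterm (n : ℕ) (s : ℂ) : ℂ :=
  (s - 1) * ((n + 1 : ℕ) : ℂ) ^ (-s) +
    (((n + 2 : ℕ) : ℂ) ^ (1 - s) - ((n + 1 : ℕ) : ℂ) ^ (1 - s))

lemma gterm_eq (n : ℕ) (s : ℂ) (hs : s ≠ 1) :
    gterm n s = (s - 1) * ∫ x in ((n + 1 : ℕ) : ℝ)..((n + 2 : ℕ) : ℝ),
      (((n + 1 : ℕ) : ℂ) ^ (-s) - (x : ℂ) ^ (-s)) := by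
  have h0 : (0 : ℝ) ∉ uIcc ((n + 1 : ℕ) : ℝ) ((n + 2 : ℕ) : ℝ) := by
    rw [uIcc_of_le (by push_cast; linarith)]
    intro h
    have := h.1
    push_cast at this
    linarith [(Nat.cast_nonneg n : (0 : ℝ) ≤ n)]
  rw [intervalIntegral.integral_sub (by simp), integral_cpow]
  · have : (-s + 1) ≠ 0 := by
      intro h; apply hs; linear_combination -h
    have h2 : s - 1 ≠ 0 := sub_ne_zero.mpr hs
    simp only [intervalIntegral.integral_const, gterm]
    have e : (-s + 1) = 1 - s := by ring
    rw [e]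
    rw [e] at this
    push_cast
    have e3 : ((n:ℝ) + 2 - (n + 1)) = 1 := by ring
    rw [e3, one_smul]
    field_simp
    ring
  · right
    refine ⟨?_, h0⟩
    intro h; apply hs; linear_combination -h
  · apply ContinuousOn.intervalIntegrable
    intro x hx
    apply ContinuousAt.continuousWithinAt
    have hx0 : 0 < x := by
      rw [uIcc_of_le (by push_cast; linarith)] at hx
      have := hx.1
      push_cast at this
      linarith [(Nat.cast_nonneg n : (0 : ℝ) ≤ n)]
    apply ContinuousAt.cpow
    · exact Complex.continuous_ofReal.continuousAt
    · exact continuousAt_const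
    · left; simpa using hx0

lemma diff_bound1 (a x : ℝ) (s : ℂ) (ha : 0 < a) (hx : a ≤ x) (hs : 0 ≤ s.re) :
    ‖(a : ℂ) ^ (-s) - (x : ℂ) ^ (-s)‖ ≤ 2 * a ^ (-s.re) := by
  refine (norm_sub_le _ _).trans ?_
  rw [Complex.norm_cpow_eq_rpow_re_of_pos ha, Complex.norm_cpow_eq_rpow_re_of_pos (by linarith)]
  have : x ^ (-s.re) ≤ a ^ (-s.re) :=
    Real.rpow_le_rpow_of_nonpos ha hx (by linarith)
  simp only [neg_re]
  linarith

lemma diff_bound2 (a x : ℝ) (s : ℂ) (ha : 0 < a) (hx : a ≤ x) (hx1 : x ≤ a + 1) (hs : 0 ≤ s.re) :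
    ‖(a : ℂ) ^ (-s) - (x : ℂ) ^ (-s)‖ ≤ ‖s‖ * a ^ (-s.re - 1) := by
  by_cases h0 : s = 0
  · simp [h0]
  have hd : ∀ y ∈ Icc a (a + 1), HasDerivWithinAt (fun y : ℝ => (y : ℂ) ^ (-s))
      (-s * (y : ℂ) ^ (-s - 1)) (Icc a (a + 1)) y := by
    intro y hy
    exact (hasDerivAt_ofReal_cpow_const (x := y) (r := -s) (by linarith [hy.1]) (by simpa using h0)).hasDerivWithinAt
  have := Convex.norm_image_sub_le_of_norm_hasDerivWithin_le (C := ‖s‖ * a ^ (-s.re - 1)) hd ?_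
    (convex_Icc a (a + 1)) (x := x) (y := a) ⟨hx, hx1⟩ ⟨le_refl _, by linarith⟩
  · refine this.trans ?_
    have h1 : ‖a - x‖ ≤ 1 := by
      rw [Real.norm_eq_abs, abs_le]; constructor <;> linarith
    have h2 : 0 ≤ ‖s‖ * a ^ (-s.re - 1) := by positivity
    nlinarith
  · intro y hy
    have hy0 : 0 < y := by linarith [hy.1]
    rw [norm_mul, norm_neg, Complex.norm_cpow_eq_rpow_re_of_pos hy0]
    gcongr
    simp only [sub_re, neg_re, one_re]
    exact Real.rpow_le_rpow_of_nonpos ha hy.1 (by linarith)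

lemma gterm_bound (n : ℕ) (s : ℂ) (hs : 0 ≤ s.re) (K : ℝ)
    (hK : ∀ x ∈ Icc ((n + 1 : ℕ) : ℝ) ((n + 2 : ℕ) : ℝ),
      ‖((n + 1 : ℕ) : ℂ) ^ (-s) - (x : ℂ) ^ (-s)‖ ≤ K) :
    ‖gterm n s‖ ≤ ‖s - 1‖ * K := by
  by_cases h1 : s = 1
  · subst h1
    simp [gterm]
  rw [gterm_eq n s h1, norm_mul]
  gcongr
  refine (intervalIntegral.norm_integral_le_of_norm_le_const (C := K) ?_).trans ?_
  · intro x hx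
    rw [uIoc_of_le (by push_cast; linarith)] at hx
    exact hK x ⟨hx.1.le, hx.2⟩
  · push_cast
    have : ((n : ℝ) + 2 - (n + 1)) = 1 := by ring
    rw [this]; simp

lemma gterm_bound2 (n : ℕ) (s : ℂ) (hs : 0 ≤ s.re) :
    ‖gterm n s‖ ≤ ‖s - 1‖ * (‖s‖ * ((n + 1 : ℕ) : ℝ) ^ (-s.re - 1)) := by
  apply gterm_bound n s hs
  intro x hx
  have := diff_bound2 ((n + 1 : ℕ) : ℝ) x s (by positivity) hx.1
    (by have := hx.2; push_cast at *; linarith) hs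
  simpa using this

lemma min_interp {y a b θ : ℝ} (hy : 0 ≤ y) (ha : y ≤ a) (hb : y ≤ b) (h0 : 0 ≤ θ) (h1 : θ ≤ 1) :
    y ≤ a ^ (1 - θ) * b ^ θ := by
  calc y = y ^ (1 - θ) * y ^ θ := by
        rcases hy.eq_or_lt with h | h
        · subst h
          by_cases hθ : θ = 0
          · subst hθ; simp
          · simp [Real.zero_rpow hθ]
        · rw [← Real.rpow_add h]; simp
    _ ≤ _ := by
        apply mul_le_mul (Real.rpow_le_rpow hy ha (by linarith)) (Real.rpow_le_rpow hy hb h0)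
        · positivity
        · exact Real.rpow_nonneg (hy.trans ha) _

lemma gterm_bound3 (n : ℕ) (s : ℂ) (hs : 1 - 1/140 ≤ s.re) :
    ‖gterm n s‖ ≤ ‖s - 1‖ * (2 * ‖s‖ ^ (1/70 : ℝ) * ((n + 1 : ℕ) : ℝ) ^ (-1 - 1/140 : ℝ)) := by
  have hs0 : 0 ≤ s.re := by linarith
  apply gterm_bound n s hs0
  intro x hx
  have ha : (0:ℝ) < ((n + 1 : ℕ) : ℝ) := by positivity
  have ha1 : (1:ℝ) ≤ ((n + 1 : ℕ) : ℝ) := by push_cast; linarith [(Nat.cast_nonneg n : (0 : ℝ) ≤ n)]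
  have b2 := diff_bound2 ((n + 1 : ℕ) : ℝ) x s ha hx.1
    (by have := hx.2; push_cast at *; linarith) hs0
  have b1 := diff_bound1 ((n + 1 : ℕ) : ℝ) x s ha hx.1 hs0
  have := min_interp (norm_nonneg _) b1 b2 (θ := 1/70) (by norm_num) (by norm_num)
  rw [ofReal_natCast] at this
  refine this.trans ?_
  rw [Real.mul_rpow (by norm_num) (by positivity), Real.mul_rpow (by positivity) (by positivity),
    ← Real.rpow_mul ha.le, ← Real.rpow_mul ha.le]
  have h2 : (2:ℝ) ^ (1 - 1/70 : ℝ) ≤ 2 := by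
    conv_rhs => rw [← Real.rpow_one 2]
    exact Real.rpow_le_rpow_of_exponent_le (by norm_num) (by norm_num)
  calc _ = (2:ℝ) ^ (1 - 1/70 : ℝ) * ‖s‖ ^ (1/70 : ℝ) *
        (((n + 1 : ℕ) : ℝ) ^ (-s.re * (1 - 1 / 70)) *
        ((n + 1 : ℕ) : ℝ) ^ ((-s.re - 1) * (1 / 70))) := by ring
    _ ≤ _ := by
      rw [← Real.rpow_add ha]
      gcongr
      linarith

lemma gterm_differentiable (n : ℕ) : Differentiable ℂ (gterm n) := by
  unfold gterm
  have h1 : ((n + 1 : ℕ) : ℂ) ≠ 0 := by exact_mod_cast (Nat.succ_ne_zero n)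
  have h2 : ((n + 2 : ℕ) : ℂ) ≠ 0 := by exact_mod_cast (Nat.succ_ne_zero (n+1))
  intro s
  have := NeZero.mk h1
  have := NeZero.mk h2
  apply DifferentiableAt.add
  · apply DifferentiableAt.mul (by fun_prop)
    exact DifferentiableAt.const_cpow (by fun_prop) (Or.inl h1)
  · exact (DifferentiableAt.const_cpow (by fun_prop) (Or.inl h2)).sub
      (DifferentiableAt.const_cpow (by fun_prop) (Or.inl h1))

lemma summable_shift (a : ℝ) (ha : a < -1) : Summable (fun n : ℕ => ((n + 1 : ℕ) : ℝ) ^ a) :=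
  (summable_nat_add_iff 1).mpr (Real.summable_nat_rpow.mpr ha)

lemma gterm_summable (s : ℂ) (hs : 0 < s.re) : Summable (fun n => gterm n s) := by
  refine Summable.of_norm_bounded ?_ (fun n => gterm_bound2 n s hs.le)
  exact ((summable_shift _ (by linarith)).mul_left _).mul_left _

lemma gterm_tsum_of_one_lt (s : ℂ) (hs : 1 < s.re) : ∑' n, gterm n s = riemannZeta₁ s - 1 := by
  have hs1 : s ≠ 1 := by rintro rfl; simp at hs
  have hz : Summable (fun n : ℕ => ((n + 1 : ℕ) : ℂ) ^ (-s)) := by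
    have := Complex.summable_one_div_nat_cpow.mpr hs
    have := (summable_nat_add_iff 1).mpr this
    refine this.congr fun n => ?_
    rw [Complex.cpow_neg, one_div]
  have hz' : ∑' n : ℕ, ((n + 1 : ℕ) : ℂ) ^ (-s) = riemannZeta s := by
    rw [zeta_eq_tsum_one_div_nat_add_one_cpow hs]
    refine tsum_congr fun n => ?_
    rw [Complex.cpow_neg, one_div]; push_cast; rfl
  have hg := gterm_summable s (by linarith)
  have hd : Summable (fun n : ℕ => ((n + 2 : ℕ) : ℂ) ^ (1 - s) - ((n + 1 : ℕ) : ℂ) ^ (1 - s)) := by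
    refine (hg.sub (hz.mul_left (s - 1))).congr fun n => ?_
    simp [gterm]
  have hd' : ∑' n : ℕ, (((n + 2 : ℕ) : ℂ) ^ (1 - s) - ((n + 1 : ℕ) : ℂ) ^ (1 - s)) = -1 := by
    have h1 := hd.hasSum.tendsto_sum_nat
    have h2 : ∀ N : ℕ, ∑ n ∈ Finset.range N, (((n + 2 : ℕ) : ℂ) ^ (1 - s) - ((n + 1 : ℕ) : ℂ) ^ (1 - s))
        = ((N + 1 : ℕ) : ℂ) ^ (1 - s) - 1 := by
      intro N
      have := Finset.sum_range_sub (fun n : ℕ => ((n + 1 : ℕ) : ℂ) ^ (1 - s)) N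
      rw [show ((0 + 1 : ℕ) : ℂ) ^ (1 - s) = 1 by simp] at this
      rw [← this]
    simp_rw [h2] at h1
    have h3 : Tendsto (fun N : ℕ => ((N + 1 : ℕ) : ℂ) ^ (1 - s)) atTop (𝓝 0) := by
      rw [tendsto_zero_iff_norm_tendsto_zero]
      have : ∀ N : ℕ, ‖((N + 1 : ℕ) : ℂ) ^ (1 - s)‖ = ((N + 1 : ℕ) : ℝ) ^ (-(s.re - 1)) := by
        intro N
        rw [Complex.norm_natCast_cpow_of_pos (Nat.succ_pos N)]
        simp
      simp_rw [this]
      exact ((tendsto_rpow_neg_atTop (by linarith)).comp tendsto_natCast_atTop_atTop).comp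
        (tendsto_add_atTop_nat 1)
    have := tendsto_nhds_unique h1 (h3.sub_const 1)
    simpa using this
  unfold gterm
  rw [(hz.mul_left (s - 1)).tsum_add hd, hd', tsum_mul_left, hz', riemannZeta_eq_inv_sub_mul hs1]
  have : s - 1 ≠ 0 := sub_ne_zero.mpr hs1
  field_simp
  ring

lemma gterm_tsum (s : ℂ) (hs : 1/2 < s.re) : ∑' n, gterm n s = riemannZeta₁ s - 1 := by
  set R : ℝ := ‖s‖ + 3 with hR
  let U : Set ℂ := {z | 1/2 < z.re} ∩ Metric.ball 0 R
  have hU : IsOpen U := (isOpen_lt continuous_const continuous_re).inter Metric.isOpen_ball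
  have hUc : Convex ℝ U := (convex_halfSpace_re_gt _).inter (convex_ball _ _)
  have h2U : (2 : ℂ) ∈ U := by
    refine ⟨by simp; norm_num, ?_⟩
    simp [hR]
    linarith [norm_nonneg s]
  have hsU : s ∈ U := ⟨hs, by simp [hR]⟩
  have hdiff : DifferentiableOn ℂ (fun z => ∑' n, gterm n z) U := by
    refine differentiableOn_tsum_of_summable_norm
      (u := fun n => (R + 1) * (R * ((n + 1 : ℕ) : ℝ) ^ (-(1/2) - 1 : ℝ))) ?_ ?_ hU ?_
    · exact ((summable_shift _ (by norm_num)).mul_left _).mul_left _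
    · exact fun n => (gterm_differentiable n).differentiableOn
    · intro n z hz
      refine (gterm_bound2 n z (by have := hz.1; simp at this; linarith)).trans ?_
      have hzR : ‖z‖ ≤ R := by have := hz.2; simp at this; exact this.le
      have h1 : ‖z - 1‖ ≤ R + 1 := (norm_sub_le _ _).trans (by simpa using hzR)
      have hz1 : 1/2 < z.re := hz.1
      gcongr
      · push_cast; linarith [(Nat.cast_nonneg n : (0 : ℝ) ≤ n)]
  have := (hdiff.analyticOnNhd hU).eqOn_of_preconnected_of_eventuallyEq
    (g := fun z => riemannZeta₁ z - 1)
    ((differentiable_riemannZeta₁.sub_const 1).differentiableOn.analyticOnNhd hU)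
    hUc.isPreconnected h2U ?_ hsU
  · exact this
  · have : {z : ℂ | 1 < z.re} ∈ 𝓝 (2 : ℂ) :=
      (isOpen_lt continuous_const continuous_re).mem_nhds (by simp)
    filter_upwards [this] with z hz using gterm_tsum_of_one_lt z hz

lemma zeta0_bound : ∃ C : ℝ, 0 < C ∧ ∀ s : ℂ, 1 - 1/140 ≤ s.re → s ≠ 1 →
    ‖riemannZeta₀ s‖ ≤ C * ‖s‖ ^ (1/70 : ℝ) := by
  have hsum := summable_shift (-1 - 1/140 : ℝ) (by norm_num)
  refine ⟨2 * (∑' n : ℕ, ((n + 1 : ℕ) : ℝ) ^ (-1 - 1/140 : ℝ)), ?_, ?_⟩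
  · have := hsum.tsum_pos (fun i => by positivity) 0 (by simp)
    linarith
  intro s hs hs1
  have h1 := gterm_tsum s (by linarith)
  have h2 : ‖∑' n, gterm n s‖ ≤ ‖s - 1‖ * (2 * ‖s‖ ^ (1/70 : ℝ) *
      ∑' n : ℕ, ((n + 1 : ℕ) : ℝ) ^ (-1 - 1/140 : ℝ)) := by
    refine tsum_of_norm_bounded ?_ (fun n => gterm_bound3 n s hs)
    exact (hsum.hasSum.mul_left _).mul_left _
  rw [h1, riemannZeta₁, add_sub_cancel_left, norm_mul] at h2
  have h3 : 0 < ‖s - 1‖ := norm_pos_iff.mpr (sub_ne_zero.mpr hs1)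
  have := le_of_mul_le_mul_left h2 h3
  linarith
end PNT


namespace PNT
open Complex Set MeasureTheory Topology ZetaAsymptotics

/-- Growth parameter `(|t|+4)^(1/70)`. -/
noncomputable def AA (t : ℝ) : ℝ := (|t| + 4) ^ (1/70 : ℝ)

lemma AA_ge_one (t : ℝ) : 1 ≤ AA t := Real.one_le_rpow (by linarith [abs_nonneg t]) (by norm_num)

lemma AA_le_two (t u : ℝ) (h : |u| + 4 ≤ 2 * (|t| + 4)) : AA u ≤ 2 * AA t := by
  unfold AA
  calc (|u| + 4) ^ (1/70 : ℝ) ≤ (2 * (|t| + 4)) ^ (1/70 : ℝ) := by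
        gcongr
    _ = 2 ^ (1/70 : ℝ) * (|t| + 4) ^ (1/70 : ℝ) := by
        rw [Real.mul_rpow (by norm_num) (by positivity)]
    _ ≤ 2 * (|t| + 4) ^ (1/70 : ℝ) := by
        gcongr
        conv_rhs => rw [← Real.rpow_one 2]
        exact Real.rpow_le_rpow_of_exponent_le (by norm_num) (by norm_num)

lemma ne_one_of_im {s : ℂ} (h : 0 < |s.im|) : s ≠ 1 := by
  rintro rfl; simp at h

lemma norm_sub_one_ge {s : ℂ} : |s.im| ≤ ‖s - 1‖ := by
  have := Complex.abs_im_le_norm (s - 1)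
  simpa using this

lemma zeta_bounds : ∃ C : ℝ, 1 ≤ C ∧ ∀ s : ℂ, 1 - 1/280 ≤ s.re → s.re ≤ 3 → 1 ≤ |s.im| →
    ‖riemannZeta s‖ ≤ C * AA s.im ∧ ‖deriv riemannZeta s‖ ≤ C * AA s.im := by
  obtain ⟨C0, hC0, hb⟩ := zeta0_bound
  refine ⟨1 + 280 * C0, by linarith, fun s h1 h2 h3 => ?_⟩
  have hs1 : s ≠ 1 := ne_one_of_im (by linarith)
  have hA := AA_ge_one s.im
  have hn : ‖s‖ ≤ 3 + |s.im| := by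
    refine (Complex.norm_le_abs_re_add_abs_im s).trans ?_
    rw [abs_of_nonneg (by linarith : 0 ≤ s.re)]; linarith
  have hsub : 1 ≤ ‖s - 1‖ := h3.trans norm_sub_one_ge
  have hinv : ‖(s - 1)⁻¹‖ ≤ 1 := by
    rw [norm_inv]; exact inv_le_one_of_one_le₀ hsub
  constructor
  · rw [riemannZeta_eq_inv_sub_add hs1]
    refine (norm_add_le _ _).trans ?_
    have := hb s (by linarith) hs1
    have h5 : ‖s‖ ^ (1/70 : ℝ) ≤ AA s.im := by
      unfold AA; gcongr; linarith
    nlinarith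
  · rw [deriv_riemannZeta_eq_neg_inv_sub_sq_add hs1]
    refine (norm_add_le _ _).trans ?_
    have h6 : ‖-((s - 1)⁻¹) ^ 2‖ ≤ 1 := by
      rw [norm_neg, norm_pow]; exact pow_le_one₀ (norm_nonneg _) hinv
    have h7 : ‖deriv riemannZeta₀ s‖ ≤ C0 * AA s.im / (1/280) := by
      refine Complex.norm_deriv_le_of_forall_mem_sphere_norm_le (by norm_num)
        differentiable_riemannZeta₀.diffContOnCl ?_
      intro z hz
      have hz' : ‖z - s‖ = 1/280 := by simpa using hz
      have hre := Complex.abs_re_le_norm (z - s)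
      have him := Complex.abs_im_le_norm (z - s)
      rw [hz', Complex.sub_re, abs_le] at hre
      rw [hz', Complex.sub_im] at him
      have him2 := abs_sub_abs_le_abs_sub s.im z.im
      rw [abs_sub_comm] at him2
      refine (hb z (by linarith) (ne_one_of_im (by linarith))).trans ?_
      have h5 : ‖z‖ ^ (1/70 : ℝ) ≤ AA s.im := by
        unfold AA; gcongr
        have : ‖z‖ ≤ ‖z - s‖ + ‖s‖ := by simpa using norm_add_le (z - s) s
        linarith
      gcongr
    nlinarith

lemma zeta_real_bound : ∃ C : ℝ, 1 ≤ C ∧ ∀ x : ℝ, 0 < x → x ≤ 2 →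
    ‖riemannZeta (1 + x)‖ ≤ C / x := by
  have hc : Continuous (fun x : ℝ => ‖riemannZeta₁ (1 + x)‖) := by
    have := differentiable_riemannZeta₁.continuous
    fun_prop
  obtain ⟨C, hC⟩ := (isCompact_Icc (a := (0:ℝ)) (b := 2)).bddAbove_image hc.continuousOn
  refine ⟨max C 1, le_max_right _ _, fun x h0 h2 => ?_⟩
  have : ‖riemannZeta₁ (1 + x)‖ ≤ C := hC ⟨x, ⟨h0.le, h2⟩, rfl⟩
  rw [riemannZeta_eq_inv_sub_mul (by simpa using h0.ne'), norm_mul]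
  simp only [add_sub_cancel_left, norm_inv, Complex.norm_real, Real.norm_eq_abs, abs_of_pos h0]
  rw [div_eq_inv_mul]
  gcongr
  exact this.trans (le_max_left _ _)

lemma three_four_one (x : ℝ) (hx : 0 < x) (y : ℝ) :
    1 ≤ ‖riemannZeta (1 + x)‖ ^ 3 * ‖riemannZeta (1 + x + I * y)‖ ^ 4 *
      ‖riemannZeta (1 + x + 2 * I * y)‖ := by
  have := DirichletCharacter.norm_LFunction_product_ge_one (1 : DirichletCharacter ℂ 1) hx y
  simpa [DirichletCharacter.LFunctionTrivChar, DirichletCharacter.LFunction_modOne_eq] using this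

lemma lower341 : ∃ c : ℝ, 0 < c ∧ ∀ x t : ℝ, 0 < x → x ≤ 2 → 1 ≤ |t| →
    c * x ^ 3 ≤ AA t * ‖riemannZeta (1 + x + I * t)‖ ^ 4 := by
  obtain ⟨C1, hC1, h1⟩ := zeta_bounds
  obtain ⟨C2, hC2, h2⟩ := zeta_real_bound
  refine ⟨1 / (C2 ^ 3 * (2 * C1)), by positivity, fun x t hx0 hx2 ht => ?_⟩
  have h := three_four_one x hx0 t
  have ha := h2 x hx0 hx2
  have hb := (h1 (1 + x + 2 * I * t) (by simp; linarith) (by simp; linarith)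
    (by simp [abs_mul]; linarith)).1
  have e : (1 + x + 2 * I * t : ℂ).im = 2 * t := by simp
  rw [e] at hb
  have hA := AA_le_two t (2 * t) (by rw [abs_mul, abs_two]; linarith)
  have hb' : ‖riemannZeta (1 + x + 2 * I * t)‖ ≤ C1 * (2 * AA t) := hb.trans (by gcongr)
  have : 1 ≤ (C2 / x) ^ 3 * ‖riemannZeta (1 + x + I * t)‖ ^ 4 * (C1 * (2 * AA t)) :=
    h.trans (by gcongr)
  have e2 : (C2 / x) ^ 3 * ‖riemannZeta (1 + x + I * t)‖ ^ 4 * (C1 * (2 * AA t)) =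
    (C2 ^ 3 * (2 * C1)) * (AA t * ‖riemannZeta (1 + x + I * t)‖ ^ 4) / x ^ 3 := by
    field_simp
  rw [e2, le_div_iff₀ (by positivity), one_mul] at this
  rw [one_div, inv_mul_le_iff₀ (by positivity)]
  exact this

lemma zeta_lower : ∃ κ c : ℝ, 0 < κ ∧ κ ≤ 1/280 ∧ 0 < c ∧ ∀ s : ℂ, 1 ≤ |s.im| →
    1 - κ / AA s.im ^ 5 ≤ s.re → s.re ≤ 3 → c / AA s.im ^ 4 ≤ ‖riemannZeta s‖ := by
  obtain ⟨C, hC, hb⟩ := zeta_bounds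
  obtain ⟨c, hc, hl⟩ := lower341
  set κ : ℝ := min (1/280) (c / (4 * C) ^ 4) with hκ
  have hκ0 : 0 < κ := lt_min (by norm_num) (by positivity)
  have hκ1 : κ ≤ 1/280 := min_le_left _ _
  have hκ2 : κ * (4 * C) ^ 4 ≤ c := by
    rw [← le_div_iff₀ (by positivity)]; exact min_le_right _ _
  -- points to the right
  have key : ∀ x t : ℝ, 1 ≤ |t| → κ / AA t ^ 5 ≤ x → x ≤ 2 →
      4 * C * κ / AA t ^ 4 ≤ ‖riemannZeta (1 + x + I * t)‖ := by
    intro x t ht hx hx2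
    have hA := AA_ge_one t
    have hA0 : 0 < AA t := by linarith
    have hx0 : 0 < x := lt_of_lt_of_le (by positivity) hx
    have h := hl x t hx0 hx2 ht
    have h3 : c * (κ / AA t ^ 5) ^ 3 ≤ AA t * ‖riemannZeta (1 + x + I * t)‖ ^ 4 :=
      le_trans (by gcongr) h
    refine le_of_pow_le_pow_left₀ (n := 4) (by norm_num) (norm_nonneg _) ?_
    have h4 : κ * (4 * C) ^ 4 * (κ / AA t ^ 5) ^ 3 ≤ AA t * ‖riemannZeta (1 + x + I * t)‖ ^ 4 :=
      le_trans (by gcongr) h3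
    have e : κ * (4 * C) ^ 4 * (κ / AA t ^ 5) ^ 3 = AA t * (4 * C * κ / AA t ^ 4) ^ 4 := by
      field_simp
    rw [e] at h4
    exact le_of_mul_le_mul_left h4 hA0
  refine ⟨κ, 2 * C * κ, hκ0, hκ1, by positivity, fun s ht h1 h3 => ?_⟩
  have hA := AA_ge_one s.im
  have hA0 : 0 < AA s.im := by linarith
  set A := AA s.im with hAdef
  have hδ1 : κ / A ^ 5 ≤ κ := div_le_self hκ0.le (one_le_pow₀ hA)
  have hδ0 : 0 < κ / A ^ 5 := by positivity
  have hs : s = 1 + ((s.re - 1 : ℝ) : ℂ) + I * s.im := by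
    apply Complex.ext <;> simp
  by_cases hcase : κ / A ^ 5 ≤ s.re - 1
  · have := key (s.re - 1) s.im ht hcase (by linarith)
    rw [← hs] at this
    refine le_trans ?_ this
    gcongr
    linarith
  · push Not at hcase
    have hk := key (κ / A ^ 5) s.im ht le_rfl (by linarith)
    set w : ℂ := 1 + ((κ / A ^ 5 : ℝ) : ℂ) + I * s.im with hw
    have hwre : w.re = 1 + κ / A ^ 5 := by rw [hw]; simp only [add_re, one_re, ofReal_re, mul_re, I_re, I_im, ofReal_im]; ring
    have hwim : w.im = s.im := by rw [hw]; simp only [add_im, one_im, ofReal_im, mul_im, I_re, I_im, ofReal_re]; ring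
    let S : Set ℂ := {z | 1 - 1/280 ≤ z.re} ∩ {z | z.re ≤ 3} ∩ {z | z.im = s.im}
    have hS : Convex ℝ S := ((convex_halfSpace_re_ge _).inter (convex_halfSpace_re_le _)).inter
      (by
        have : {z : ℂ | z.im = s.im} = {z : ℂ | z.im ≤ s.im} ∩ {z : ℂ | s.im ≤ z.im} := by
          ext z; simp [le_antisymm_iff]
        rw [this]
        exact (convex_halfSpace_im_le _).inter (convex_halfSpace_im_ge _))
    have hmv := hS.norm_image_sub_le_of_norm_deriv_le (f := riemannZeta) (C := C * A)
      (x := w) (y := s) ?_ ?_ ?_ ?_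
    · have hd : ‖s - w‖ ≤ 2 * (κ / A ^ 5) := by
        have : s - w = ((s.re - 1 - κ / A ^ 5 : ℝ) : ℂ) := by
          apply Complex.ext
          · rw [sub_re, hwre, ofReal_re]; ring
          · rw [sub_im, hwim, ofReal_im]; ring
        rw [this, Complex.norm_real, Real.norm_eq_abs, abs_le]
        constructor <;> linarith
      have h8 : ‖riemannZeta w‖ ≤ ‖riemannZeta s‖ + ‖riemannZeta s - riemannZeta w‖ := by
        have := norm_sub_le (riemannZeta s) (riemannZeta s - riemannZeta w)
        simpa using this
      have h9 : C * A * ‖s - w‖ ≤ C * A * (2 * (κ / A ^ 5)) := by gcongr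
      have e1 : C * A * (2 * (κ / A ^ 5)) = 2 * C * κ / A ^ 4 := by field_simp
      have e2 : 4 * C * κ / A ^ 4 = 2 * C * κ / A ^ 4 + 2 * C * κ / A ^ 4 := by ring
      linarith
    · intro z hz
      have : z.im = s.im := hz.2
      exact differentiableAt_riemannZeta (ne_one_of_im (by rw [this]; linarith))
    · intro z hz
      have hzi : z.im = s.im := hz.2
      have := (hb z hz.1.1 hz.1.2 (by rw [hzi]; exact ht)).2
      rwa [hzi] at this
    · refine ⟨⟨?_, ?_⟩, hwim⟩
      · show 1 - 1/280 ≤ w.re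
        linarith
      · show w.re ≤ 3
        linarith
    · refine ⟨⟨?_, h3⟩, rfl⟩
      show 1 - 1/280 ≤ s.re
      linarith

/-- The regular function: minus the logarithmic derivative of zeta, minus zeta. -/
noncomputable def GG (s : ℂ) : ℂ := - deriv riemannZeta₁ s / riemannZeta₁ s - riemannZeta₀ s

lemma GG_eq {s : ℂ} (hs : s ≠ 1) (h0 : riemannZeta s ≠ 0) :
    GG s = - deriv riemannZeta s / riemannZeta s - riemannZeta s := by
  have h1 : s - 1 ≠ 0 := sub_ne_zero.mpr hs
  have h2 : riemannZeta₁ s ≠ 0 := by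
    intro h; apply h0; rw [riemannZeta_eq_inv_sub_mul hs, h, mul_zero]
  rw [GG, deriv_riemannZeta_eq_neg_inv_sub_sq_mul_add hs]
  have h3 : riemannZeta₀ s = riemannZeta s - (s - 1)⁻¹ := by
    rw [riemannZeta_eq_inv_sub_add hs]; ring
  rw [h3, riemannZeta_eq_inv_sub_mul hs]
  field_simp
  ring

lemma GG_differentiableOn : DifferentiableOn ℂ GG {s | riemannZeta₁ s ≠ 0} := by
  unfold GG
  have h1 : Differentiable ℂ (deriv riemannZeta₁) := differentiable_riemannZeta₁.deriv
  intro s hs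
  exact (((h1 s).neg.div (differentiable_riemannZeta₁ s) hs).sub
    (differentiable_riemannZeta₀ s)).differentiableWithinAt

lemma isOpen_ne : IsOpen {s | riemannZeta₁ s ≠ 0} :=
  isOpen_ne_fun differentiable_riemannZeta₁.continuous continuous_const

lemma zeta1_ne_zero {s : ℂ} (hs : 1 ≤ s.re) : riemannZeta₁ s ≠ 0 := by
  by_cases h : s = 1
  · simp [h]
  · intro h0
    exact riemannZeta_ne_zero_of_one_le_re hs (by rw [riemannZeta_eq_inv_sub_mul h, h0, mul_zero])

lemma GG_bound_small : ∃ C : ℝ, ∀ s : ℂ, 1 ≤ s.re → s.re ≤ 2 → |s.im| ≤ 2 →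
    ‖iteratedDeriv 6 GG s‖ ≤ C := by
  have hc : ContinuousOn (iteratedDeriv 6 GG) {s | riemannZeta₁ s ≠ 0} := by
    have : AnalyticOnNhd ℂ GG {s | riemannZeta₁ s ≠ 0} := GG_differentiableOn.analyticOnNhd isOpen_ne
    rw [iteratedDeriv_eq_iterate]
    exact (this.iterated_deriv 6).continuousOn
  have hK : IsCompact (Icc (1:ℝ) 2 ×ℂ Icc (-2:ℝ) 2) := isCompact_Icc.reProdIm isCompact_Icc
  obtain ⟨C, hC⟩ := hK.exists_bound_of_continuousOn (hc.mono fun s hs => zeta1_ne_zero hs.1.1)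
  exact ⟨C, fun s h1 h2 h3 => hC s ⟨⟨h1, h2⟩, abs_le.mp h3⟩⟩

lemma GG_bound_large : ∃ C : ℝ, ∀ s : ℂ, 1 ≤ s.re → s.re ≤ 2 → 2 ≤ |s.im| →
    ‖iteratedDeriv 6 GG s‖ ≤ C * (|s.im| + 4) ^ (1/2 : ℝ) := by
  obtain ⟨C, hC, hb⟩ := zeta_bounds
  obtain ⟨κ, c, hκ, hκ1, hc, hl⟩ := zeta_lower
  refine ⟨720 * ((C * 2) * 2 ^ 4 / c + C * 2) / (κ / 32) ^ 6, fun s h1 h2 h3 => ?_⟩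
  have hA := AA_ge_one s.im
  have hA0 : 0 < AA s.im := by linarith
  set A := AA s.im with hAdef
  set r := κ / 32 / A ^ 5 with hr
  have hr0 : 0 < r := by positivity
  have hr1 : r ≤ 1/280 := by
    refine (div_le_self (by positivity) (one_le_pow₀ hA)).trans (by linarith)
  have hball : ∀ z ∈ Metric.closedBall s r, riemannZeta z ≠ 0 ∧ z ≠ 1 ∧ 
      ‖GG z‖ ≤ ((C * 2) * 2 ^ 4 / c + C * 2) * A ^ 5 := by
    intro z hz
    have hz' : ‖z - s‖ ≤ r := by simpa [dist_eq_norm] using hz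
    have hre := (Complex.abs_re_le_norm (z - s)).trans hz'
    have him := (Complex.abs_im_le_norm (z - s)).trans hz'
    rw [Complex.sub_re, abs_le] at hre
    rw [Complex.sub_im] at him
    have him2 := abs_sub_abs_le_abs_sub s.im z.im
    have him3 := abs_sub_abs_le_abs_sub z.im s.im
    rw [abs_sub_comm] at him2
    have hAz := AA_ge_one z.im
    have hA2 : AA z.im ≤ 2 * A := AA_le_two _ _ (by linarith)
    have hz1 : 1 ≤ |z.im| := by linarith
    have hrz : r ≤ κ / AA z.im ^ 5 := by
      rw [hr, div_div, show (32:ℝ) * A ^ 5 = (2 * A) ^ 5 by ring]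
      gcongr
    have hlow := hl z hz1 (by linarith) (by linarith)
    have hup := hb z (by linarith) (by linarith) hz1
    have hpos : 0 < c / AA z.im ^ 4 := by positivity
    have hne : riemannZeta z ≠ 0 := by
      intro h; rw [h, norm_zero] at hlow; linarith
    have hz1' := ne_one_of_im (s := z) (by linarith)
    refine ⟨hne, hz1', ?_⟩
    rw [GG_eq hz1' hne]
    have hlow2 : c / (2 * A) ^ 4 ≤ ‖riemannZeta z‖ := le_trans (by gcongr) hlow
    refine (norm_sub_le _ _).trans ?_
    rw [norm_div, norm_neg]
    have k1 : ‖deriv riemannZeta z‖ / ‖riemannZeta z‖ ≤ C * (2 * A) / (c / (2 * A) ^ 4) := by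
      gcongr
      exact hup.2.trans (by gcongr)
    have k2 : ‖riemannZeta z‖ ≤ C * (2 * A) := hup.1.trans (by gcongr)
    have k3 : C * (2 * A) ≤ C * 2 * A ^ 5 := by
      have : A ≤ A ^ 5 := le_self_pow₀ hA (by norm_num)
      nlinarith
    have e : C * (2 * A) / (c / (2 * A) ^ 4) = (C * 2) * 2 ^ 4 / c * A ^ 5 := by
      field_simp
    rw [e] at k1
    linarith
  have hd : DiffContOnCl ℂ GG (Metric.ball s r) := by
    apply DifferentiableOn.diffContOnCl
    refine GG_differentiableOn.mono ?_
    intro z hz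
    have hz2 := Metric.closure_ball_subset_closedBall hz
    obtain ⟨k1, k2, -⟩ := hball z hz2
    intro h
    exact k1 (by rw [riemannZeta_eq_inv_sub_mul k2, h, mul_zero])
  have := Complex.norm_iteratedDeriv_le_of_forall_mem_sphere_norm_le 6 hr0 hd
    (fun z hz => (hball z (Metric.sphere_subset_closedBall hz)).2.2)
  refine this.trans (le_of_eq ?_)
  have hA35 : (|s.im| + 4) ^ (1/2 : ℝ) = A ^ 35 := by
    rw [hAdef, AA, ← Real.rpow_natCast, ← Real.rpow_mul (by positivity)]
    norm_num
  rw [hA35, hr]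
  simp only [Nat.factorial]
  push_cast
  field_simp

lemma GG_bound : ∃ C : ℝ, 0 < C ∧ ∀ s : ℂ, 1 ≤ s.re → s.re ≤ 2 →
    ‖iteratedDeriv 6 GG s‖ ≤ C * (|s.im| + 4) ^ (1/2 : ℝ) := by
  obtain ⟨C1, h1⟩ := GG_bound_small
  obtain ⟨C2, h2⟩ := GG_bound_large
  refine ⟨max 1 (max C1 C2), by positivity, fun s hs1 hs2 => ?_⟩
  have hp : 1 ≤ (|s.im| + 4) ^ (1/2 : ℝ) :=
    Real.one_le_rpow (by linarith [abs_nonneg s.im]) (by norm_num)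
  have hm0 : (0:ℝ) ≤ max 1 (max C1 C2) := by positivity
  rcases le_total |s.im| 2 with h | h
  · refine (h1 s hs1 hs2 h).trans ?_
    have : C1 ≤ max 1 (max C1 C2) := (le_max_left _ _).trans (le_max_right _ _)
    nlinarith
  · refine (h2 s hs1 hs2 h).trans ?_
    gcongr
    exact (le_max_right _ _).trans (le_max_right _ _)

/-- The coefficients. -/
noncomputable def co (n : ℕ) : ℂ := (ArithmeticFunction.vonMangoldt n : ℂ) - 1

open LSeries in
lemma co_summable {s : ℂ} (hs : 1 < s.re) : LSeriesSummable co s :=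
  LSeriesSummable.sub (ArithmeticFunction.LSeriesSummable_vonMangoldt hs)
    (LSeriesSummable_one_iff.mpr hs)

open LSeries in
lemma LSeries_co {s : ℂ} (hs : 1 < s.re) : LSeries co s = GG s := by
  have hs1 : s ≠ 1 := by rintro rfl; simp at hs
  rw [GG_eq hs1 (riemannZeta_ne_zero_of_one_le_re hs.le)]
  rw [← ArithmeticFunction.LSeries_vonMangoldt_eq_deriv_riemannZeta_div hs,
    ← LSeries_one_eq_riemannZeta hs]
  exact LSeries_sub (ArithmeticFunction.LSeriesSummable_vonMangoldt hs)
    (LSeriesSummable_one_iff.mpr hs)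

open LSeries in
lemma co_abscissa : abscissaOfAbsConv co ≤ 1 :=
  abscissaOfAbsConv_le_of_forall_lt_LSeriesSummable' (fun y hy => co_summable (by simpa using (show (1:ℝ) < y by exact_mod_cast hy)))

open LSeries in
lemma LSeries_logMul6_bound : ∃ C : ℝ, 0 < C ∧ ∀ s : ℂ, 1 < s.re → s.re ≤ 2 →
    ‖LSeries (logMul^[6] co) s‖ ≤ C * (|s.im| + 4) ^ (1/2 : ℝ) := by
  obtain ⟨C, hC, h⟩ := GG_bound
  refine ⟨C, hC, fun s h1 h2 => ?_⟩
  have e := LSeries_iteratedDeriv (f := co) 6 (s := s)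
    (lt_of_le_of_lt co_abscissa (by exact_mod_cast h1))
  have e2 : iteratedDeriv 6 (LSeries co) s = iteratedDeriv 6 GG s := by
    apply Filter.EventuallyEq.iteratedDeriv_eq
    filter_upwards [(isOpen_lt continuous_const continuous_re).mem_nhds h1] with z hz
    exact LSeries_co hz
  rw [e2] at e
  have e3 : LSeries (logMul^[6] co) s = iteratedDeriv 6 GG s := by
    rw [e]; norm_num
  rw [e3]
  exact h s h1.le h2

open LSeries in
lemma logMul6_summable {s : ℂ} (hs : 1 < s.re) : LSeriesSummable (logMul^[6] co) s := by
  apply LSeriesSummable_of_abscissaOfAbsConv_lt_re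
  rw [absicssaOfAbsConv_logPowMul]
  exact lt_of_le_of_lt co_abscissa (by exact_mod_cast hs)

end PNT


namespace PNT
open Complex Set MeasureTheory Topology

lemma kernel_norm (σ t : ℝ) (hσ : 1 ≤ σ) :
    ‖1 / ((σ + t * I : ℂ)) - 1 / ((σ + t * I : ℂ) + 1)‖ ≤ (1 + t ^ 2)⁻¹ := by
  set s : ℂ := σ + t * I with hs
  have hre : s.re = σ := by simp [hs]
  have him : s.im = t := by simp [hs]
  have h0 : s ≠ 0 := by
    intro h; rw [h] at hre; simp at hre; linarith
  have h1 : s + 1 ≠ 0 := by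
    intro h; have := congrArg Complex.re h; simp [hre] at this; linarith
  have e : 1 / s - 1 / (s + 1) = 1 / (s * (s + 1)) := by
    field_simp; ring
  rw [e, norm_div, norm_one, norm_mul, one_div]
  apply inv_anti₀ (by positivity)
  have n1 : ‖s‖ ^ 2 = σ ^ 2 + t ^ 2 := by
    rw [← Complex.normSq_eq_norm_sq, Complex.normSq_apply, hre, him]; ring
  have n2 : ‖s + 1‖ ^ 2 = (σ + 1) ^ 2 + t ^ 2 := by
    rw [← Complex.normSq_eq_norm_sq, Complex.normSq_apply]; simp [hre, him]; ring
  have h2 : ‖s‖ ≤ ‖s + 1‖ := by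
    apply le_of_sq_le_sq _ (norm_nonneg _)
    rw [n1, n2]; nlinarith
  have h3 : ‖s‖ * ‖s‖ ≤ ‖s‖ * ‖s + 1‖ := by gcongr
  nlinarith

lemma kernel_cont (σ : ℝ) (hσ : 1 ≤ σ) :
    Continuous (fun t : ℝ => 1 / ((σ + t * I : ℂ)) - 1 / ((σ + t * I : ℂ) + 1)) := by
  have h0 : ∀ t : ℝ, (σ + t * I : ℂ) ≠ 0 := by
    intro t h; have := congrArg Complex.re h; simp at this; linarith
  have h1 : ∀ t : ℝ, (σ + t * I : ℂ) + 1 ≠ 0 := by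
    intro t h; have := congrArg Complex.re h; simp at this; linarith
  apply Continuous.sub
  · exact continuous_const.div (by fun_prop) h0
  · exact continuous_const.div (by fun_prop) h1

lemma perron (σ y : ℝ) (hσ : 1 ≤ σ) (hy : 0 < y) :
    (1 / (2 * π)) • ∫ t : ℝ, (y : ℂ) ^ (-(σ + t * I : ℂ)) •
      (1 / ((σ + t * I : ℂ)) - 1 / ((σ + t * I : ℂ) + 1)) = ((max (1 - y) 0 : ℝ) : ℂ) := by
  set f : ℝ → ℂ := fun t => indicator (Ioc 0 1) (fun _ => 1 : ℝ → ℂ) t -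
    indicator (Ioc 0 1) (fun t => (t : ℂ) ^ (1 : ℂ) : ℝ → ℂ) t with hf
  have hm : ∀ s : ℂ, 0 < s.re → HasMellin f s (1 / s - 1 / (s + 1)) := by
    intro s hs
    have h1 := hasMellin_one_Ioc hs
    have h2 := hasMellin_cpow_Ioc 1 (s := s) (by simp; linarith)
    have h3 := hasMellin_sub h1.1 h2.1
    rw [h1.2, h2.2] at h3
    exact h3
  have hfeq : ∀ t : ℝ, 0 < t → f t = ((max (1 - t) 0 : ℝ) : ℂ) := by
    intro t ht
    by_cases h : t ≤ 1
    · have : t ∈ Ioc (0:ℝ) 1 := ⟨ht, h⟩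
      simp [hf, this, max_eq_left (by linarith : 0 ≤ 1 - t)]
    · have : t ∉ Ioc (0:ℝ) 1 := fun h' => h h'.2
      rw [max_eq_right (by linarith)]
      simp only [hf, Set.indicator_of_notMem this]
      simp
  have hre : ∀ t : ℝ, (σ + t * I : ℂ).re = σ := by intro t; simp
  have hmel : ∀ t : ℝ, mellin f (σ + t * I) =
      1 / ((σ + t * I : ℂ)) - 1 / ((σ + t * I : ℂ) + 1) := by
    intro t
    exact (hm _ (by rw [hre]; linarith)).2
  have := mellinInv_mellin_eq σ f hy (hm σ (by simp; linarith)).1 ?_ ?_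
  · rw [mellinInv] at this
    simp_rw [hmel] at this
    rw [this, hfeq y hy]
  · unfold VerticalIntegrable
    simp_rw [hmel]
    refine integrable_inv_one_add_sq.mono' (kernel_cont σ hσ).aestronglyMeasurable ?_
    exact Filter.Eventually.of_forall fun t => kernel_norm σ t hσ
  · have h1 : ContinuousAt (fun t : ℝ => ((max (1 - t) 0 : ℝ) : ℂ)) y := by
      apply Continuous.continuousAt
      exact Complex.continuous_ofReal.comp (by fun_prop)
    refine h1.congr ?_
    filter_upwards [lt_mem_nhds hy] with t ht using (hfeq t ht).symm

lemma weight_integrable : Integrable (fun t : ℝ => (|t| + 4) ^ (1/2 : ℝ) * (1 + t ^ 2)⁻¹) := by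
  have h := integrable_rpow_neg_one_add_norm_sq (E := ℝ) (μ := volume) (r := 3/2) (by simp; norm_num)
  refine (h.const_mul ((25:ℝ) ^ (1/4 : ℝ))).mono' ?_ (Filter.Eventually.of_forall fun t => ?_)
  · apply Continuous.aestronglyMeasurable
    apply Continuous.mul
    · exact Continuous.rpow_const (by fun_prop) (fun t => Or.inr (by norm_num))
    · exact Continuous.inv₀ (by fun_prop) (fun t => by positivity)
  · have h1 : (0:ℝ) < 1 + t ^ 2 := by positivity
    rw [Real.norm_of_nonneg (by positivity), Real.norm_eq_abs, sq_abs]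
    have h2 : (|t| + 4) ^ (1/2 : ℝ) ≤ (25:ℝ) ^ (1/4 : ℝ) * (1 + t ^ 2) ^ (1/4 : ℝ) := by
      rw [← Real.mul_rpow (by norm_num) h1.le]
      have : (|t| + 4) ^ (1/2 : ℝ) = ((|t| + 4) ^ 2) ^ (1/4 : ℝ) := by
        rw [← Real.rpow_natCast, ← Real.rpow_mul (by positivity)]; norm_num
      rw [this]
      gcongr
      have := sq_abs t
      nlinarith [sq_nonneg (|t| - 1), abs_nonneg t]
    calc _ ≤ ((25:ℝ) ^ (1/4 : ℝ) * (1 + t ^ 2) ^ (1/4 : ℝ)) * (1 + t ^ 2)⁻¹ := by gcongr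
      _ = _ := by
        rw [mul_assoc, ← Real.rpow_neg_one (1 + t ^ 2), ← Real.rpow_add h1]; norm_num

lemma smooth_identity (a : ℕ → ℂ) (ha0 : a 0 = 0) (σ x : ℝ) (hσ : 1 ≤ σ) (hx : 0 < x)
    (hs : LSeriesSummable a σ) :
    HasSum (fun n : ℕ => a n * ((max (1 - n / x) 0 : ℝ) : ℂ))
      ((1 / (2 * π)) • ∫ t : ℝ, LSeries a (σ + t * I) * ((x : ℂ) ^ (σ + t * I : ℂ) *
        (1 / ((σ + t * I : ℂ)) - 1 / ((σ + t * I : ℂ) + 1)))) := by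
  have hx' : (x : ℂ) ≠ 0 := by exact_mod_cast hx.ne'
  let F : ℕ → ℝ → ℂ := fun n t => LSeries.term a (σ + t * I) n * ((x : ℂ) ^ (σ + t * I : ℂ) *
        (1 / ((σ + t * I : ℂ)) - 1 / ((σ + t * I : ℂ) + 1)))
  have hnorm : ∀ n t, ‖F n t‖ ≤ ‖LSeries.term a σ n‖ * x ^ σ * (1 + t ^ 2)⁻¹ := by
    intro n t
    simp only [F]
    rw [norm_mul, norm_mul, LSeries.norm_term_eq, LSeries.norm_term_eq,
      Complex.norm_cpow_eq_rpow_re_of_pos hx]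
    simp only [add_re, ofReal_re, mul_re, I_re, I_im, ofReal_im, mul_zero, zero_mul, sub_self,
      add_zero]
    rw [← mul_assoc]
    gcongr
    exact kernel_norm σ t hσ
  have hcont : ∀ n, Continuous (F n) := by
    intro n
    simp only [F]
    apply Continuous.mul
    · rcases Nat.eq_zero_or_pos n with h | h
      · subst h; simp [LSeries.term_zero]; exact continuous_const
      · simp_rw [LSeries.term_of_ne_zero h.ne']
        have hn : (n : ℂ) ≠ 0 := by exact_mod_cast h.ne'
        refine continuous_const.div ?_ (fun t => ?_)
        · exact Continuous.const_cpow (by fun_prop) (Or.inl hn)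
        · simp [Complex.cpow_eq_zero_iff, hn]
    · exact (Continuous.const_cpow (by fun_prop) (Or.inl hx')).mul (kernel_cont σ hσ)
  have hFint : ∀ n, Integrable (F n) := fun n =>
    (integrable_inv_one_add_sq.const_mul _).mono' (hcont n).aestronglyMeasurable
      (Filter.Eventually.of_forall (hnorm n))
  have hsum : Summable (fun n => ∫ t, ‖F n t‖) := by
    refine Summable.of_nonneg_of_le (fun n => integral_nonneg fun t => norm_nonneg _) (fun n => ?_)
      ((hs.norm.mul_right (x ^ σ)).mul_right (∫ t : ℝ, (1 + t ^ 2)⁻¹))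
    rw [← integral_const_mul]
    exact integral_mono (hFint n).norm (integrable_inv_one_add_sq.const_mul _) (hnorm n)
  have key := (hasSum_integral_of_summable_integral_norm hFint hsum).const_smul (1 / (2 * π))
  have e1 : (fun t : ℝ => LSeries a (σ + t * I) * ((x : ℂ) ^ (σ + t * I : ℂ) *
        (1 / ((σ + t * I : ℂ)) - 1 / ((σ + t * I : ℂ) + 1)))) = fun t => ∑' n, F n t := by
    ext t
    simp only [F]
    rw [tsum_mul_right]; rfl
  rw [e1]
  suffices hh : ∀ n : ℕ, a n * ((max (1 - n / x) 0 : ℝ) : ℂ) = (1 / (2 * π)) • ∫ t, F n t by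
    rw [show (fun n : ℕ => a n * ((max (1 - n / x) 0 : ℝ) : ℂ)) =
      fun n => (1 / (2 * π)) • ∫ t, F n t from funext hh]
    exact key
  intro n
  rcases Nat.eq_zero_or_pos n with h | h
  · subst h; simp [F, ha0, LSeries.term_zero]
  · have hn : (n : ℂ) ≠ 0 := by exact_mod_cast h.ne'
    have hnr : (0 : ℝ) < n := by exact_mod_cast h
    rw [← perron σ (n / x) hσ (by positivity), mul_smul_comm, ← integral_const_mul]
    congr 1
    apply integral_congr_ae (Filter.Eventually.of_forall fun t => ?_)
    simp only [F, LSeries.term_of_ne_zero h.ne', smul_eq_mul]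
    have : ((n / x : ℝ) : ℂ) ^ (-(σ + t * I : ℂ)) = (x : ℂ) ^ (σ + t * I : ℂ) / (n : ℂ) ^ (σ + t * I : ℂ) := by
      rw [Complex.cpow_neg, Complex.ofReal_div, Complex.div_cpow_ofReal_nonneg hnr.le hx.le, inv_div]
      simp
    rw [this]
    ring

lemma logMul_iter (f : ℕ → ℂ) (k n : ℕ) :
    (LSeries.logMul^[k] f) n = (Complex.log n) ^ k * f n := by
  induction k generalizing f with
  | zero => simp
  | succ k ih => rw [Function.iterate_succ_apply, ih, LSeries.logMul]; ring

lemma smooth_bound : ∃ K : ℝ, 0 < K ∧ ∀ x : ℝ, 3 ≤ x →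
    ‖∑' n : ℕ, (LSeries.logMul^[6] co) n * ((max (1 - n / x) 0 : ℝ) : ℂ)‖ ≤ K * x := by
  obtain ⟨C, hC, hb⟩ := LSeries_logMul6_bound
  set W := ∫ t : ℝ, (|t| + 4) ^ (1/2 : ℝ) * (1 + t ^ 2)⁻¹ with hW
  have hW0 : 0 ≤ W := integral_nonneg fun t => by positivity
  refine ⟨(1 / (2 * π)) * (C * Real.exp 1 * W) + 1, by positivity, fun x hx => ?_⟩
  have hx0 : 0 < x := by linarith
  have hlog : 1 ≤ Real.log x := by
    rw [Real.le_log_iff_exp_le hx0]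
    linarith [Real.exp_one_lt_d9]
  set σ := 1 + 1 / Real.log x with hσ
  have hl0 : 0 < 1 / Real.log x := by positivity
  have hl1 : 1 / Real.log x ≤ 1 := by
    rw [div_le_one (by linarith)]; exact hlog
  have hσ1 : 1 ≤ σ := by linarith
  have hxσ : x ^ σ = x * Real.exp 1 := by
    rw [hσ, Real.rpow_add hx0, Real.rpow_one, Real.rpow_def_of_pos hx0]
    congr 2
    field_simp
  rw [(smooth_identity _ (by rw [logMul_iter]; simp) σ x hσ1 hx0
    (logMul6_summable (by simp; linarith))).tsum_eq, norm_smul, Real.norm_of_nonneg (by positivity)]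
  have : ‖∫ t : ℝ, LSeries (LSeries.logMul^[6] co) (σ + t * I) * ((x : ℂ) ^ (σ + t * I : ℂ) *
        (1 / ((σ + t * I : ℂ)) - 1 / ((σ + t * I : ℂ) + 1)))‖ ≤
      ∫ t : ℝ, (C * (x * Real.exp 1)) * ((|t| + 4) ^ (1/2 : ℝ) * (1 + t ^ 2)⁻¹) := by
    refine norm_integral_le_of_norm_le (weight_integrable.const_mul _)
      (Filter.Eventually.of_forall fun t => ?_)
    rw [norm_mul, norm_mul, Complex.norm_cpow_eq_rpow_re_of_pos hx0]
    have h1 := hb (σ + t * I) (by simp; linarith) (by simp; linarith)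
    have h2 := kernel_norm σ t hσ1
    have e1 : (σ + t * I : ℂ).im = t := by simp
    have e2 : (σ + t * I : ℂ).re = σ := by simp
    rw [e1] at h1
    rw [e2, hxσ]
    calc _ ≤ (C * (|t| + 4) ^ (1/2 : ℝ)) * ((x * Real.exp 1) * (1 + t ^ 2)⁻¹) := by gcongr
      _ = _ := by ring
  rw [integral_const_mul, ← hW] at this
  calc _ ≤ 1 / (2 * π) * (C * (x * Real.exp 1) * W) := by gcongr
    _ ≤ _ := by nlinarith

/-- real coefficients -/
noncomputable def ar (n : ℕ) : ℝ := (ArithmeticFunction.vonMangoldt n - 1) * Real.log n ^ 6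

lemma smooth_real : ∃ K : ℝ, 0 < K ∧ ∀ N : ℕ, 3 ≤ N →
    |∑ n ∈ Finset.range N, ar n * ((N : ℝ) - n)| ≤ K * (N : ℝ) ^ 2 := by
  obtain ⟨K, hK, h⟩ := smooth_bound
  refine ⟨K, hK, fun N hN => ?_⟩
  have hN' : (3 : ℝ) ≤ N := by exact_mod_cast hN
  have hN0 : (0 : ℝ) < N := by linarith
  have := h N hN'
  rw [tsum_eq_sum (s := Finset.range N)] at this
  · have e : ∑ n ∈ Finset.range N, (LSeries.logMul^[6] co) n * ((max (1 - n / (N:ℝ)) 0 : ℝ) : ℂ) =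
      (((∑ n ∈ Finset.range N, ar n * ((N : ℝ) - n)) / N : ℝ) : ℂ) := by
      rw [Finset.sum_div, Complex.ofReal_sum]
      refine Finset.sum_congr rfl fun n hn => ?_
      have hn' : (n : ℝ) ≤ N := by exact_mod_cast (Finset.mem_range.mp hn).le
      rw [logMul_iter, max_eq_left (by rw [sub_nonneg]; exact div_le_one_of_le₀ hn' hN0.le), co, ar,
        ← Complex.natCast_log]
      have : (N : ℂ) ≠ 0 := by exact_mod_cast hN0.ne'
      push_cast
      field_simp
    rw [e, Complex.norm_real, norm_div, Real.norm_of_nonneg hN0.le, div_le_iff₀ hN0] at this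
    rw [← Real.norm_eq_abs]
    linarith
  · intro n hn
    have hn' : (N : ℝ) ≤ n := by exact_mod_cast (by simpa using hn : N ≤ n)
    rw [max_eq_right]
    · simp
    · rw [sub_nonpos, le_div_iff₀ hN0]; linarith
end PNT


namespace PNT

lemma log_pow_le (k : ℕ) (c : ℝ) : ∀ᶠ N : ℕ in atTop, c * Real.log N ^ k ≤ N := by
  have h := (Real.isLittleO_pow_log_id_atTop (n := k)).comp_tendsto tendsto_natCast_atTop_atTop
  have h2 := h.def (c := 1 / (|c| + 1)) (by positivity)
  filter_upwards [h2] with N hN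
  simp only [Function.comp, Real.norm_eq_abs, id, Nat.abs_cast] at hN
  have h3 : (|c| + 1) * |Real.log N ^ k| ≤ N := by
    rw [one_div, inv_mul_eq_div, le_div_iff₀ (by positivity)] at hN
    linarith
  calc c * Real.log N ^ k ≤ |c * Real.log N ^ k| := le_abs_self _
    _ = |c| * |Real.log N ^ k| := abs_mul _ _
    _ ≤ (|c| + 1) * |Real.log N ^ k| := by gcongr; linarith
    _ ≤ N := h3

lemma log_ge (c : ℝ) : ∀ᶠ N : ℕ in atTop, c ≤ Real.log N :=
  (Real.tendsto_log_atTop.comp tendsto_natCast_atTop_atTop).eventually_ge_atTop c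

noncomputable def sumA (N : ℕ) : ℝ := ∑ n ∈ Finset.range N, ar n
noncomputable def SS (N : ℕ) : ℝ := ∑ n ∈ Finset.range N, ar n * ((N : ℝ) - n)

lemma SS_succ (N : ℕ) : SS (N + 1) = SS N + sumA (N + 1) := by
  have : sumA (N + 1) = ∑ n ∈ Finset.range N, ar n + ar N := Finset.sum_range_succ _ _
  rw [this, SS, SS, Finset.sum_range_succ, ← add_assoc, ← Finset.sum_add_distrib]
  push_cast
  congr 1
  · exact Finset.sum_congr rfl fun n _ => by ring
  · ring

lemma SS_add (M h : ℕ) : SS (M + h) = SS M + ∑ j ∈ Finset.range h, sumA (M + 1 + j) := by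
  induction h with
  | zero => simp
  | succ h ih =>
    rw [← add_assoc, SS_succ, ih, Finset.sum_range_succ, show M + h + 1 = M + 1 + h by ring]
    ring

lemma ar_ge (n N : ℕ) (hn : n < N) : -(Real.log N ^ 6) ≤ ar n := by
  rw [ar]
  have h1 : 0 ≤ ArithmeticFunction.vonMangoldt n := ArithmeticFunction.vonMangoldt_nonneg
  rcases Nat.eq_zero_or_pos n with h | h
  · subst h; simp; positivity
  have h2 : 0 ≤ Real.log n := Real.log_natCast_nonneg n
  have h3 : Real.log n ≤ Real.log N :=
    Real.log_le_log (by exact_mod_cast h) (by exact_mod_cast hn.le)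
  have h4 : Real.log n ^ 6 ≤ Real.log N ^ 6 := by gcongr
  have h5 : 0 ≤ Real.log n ^ 6 := by positivity
  nlinarith [mul_nonneg h1 h5]

lemma sumA_le (m k : ℕ) : sumA m ≤ sumA (m + k) + k * Real.log ((m + k : ℕ)) ^ 6 := by
  rw [sumA, sumA, Finset.sum_range_add]
  have : -((k : ℝ) * Real.log ((m + k : ℕ)) ^ 6) ≤ ∑ x ∈ Finset.range k, ar (m + x) := by
    have := Finset.card_nsmul_le_sum (Finset.range k) (fun x => ar (m + x))
      (-(Real.log ((m + k : ℕ)) ^ 6))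
      (fun x hx => ar_ge _ _ (by have := Finset.mem_range.mp hx; omega))
    simpa using this
  linarith

lemma sumA_lower : ∃ C : ℝ, 0 < C ∧ ∀ᶠ N : ℕ in atTop, -(C * (N * Real.log N ^ 3)) ≤ sumA N := by
  obtain ⟨K, hK, hS⟩ := smooth_real
  refine ⟨2 + 2 * K, by positivity, ?_⟩
  filter_upwards [log_ge 2, log_pow_le 3 1, eventually_ge_atTop 8] with N hL hL3 hN
  have hN8 : (8 : ℝ) ≤ N := by exact_mod_cast hN
  set L := Real.log N with hLdef
  set h := ⌈(N : ℝ) / L ^ 3⌉₊ with hh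
  have hL8 : 8 ≤ L ^ 3 := by nlinarith [pow_le_pow_left₀ (by norm_num) hL 3]
  have h1 : (N : ℝ) / L ^ 3 ≤ h := Nat.le_ceil _
  have h2 : (h : ℝ) < N / L ^ 3 + 1 := Nat.ceil_lt_add_one (by positivity)
  have h3 : 1 ≤ (N : ℝ) / L ^ 3 := by
    rw [le_div_iff₀ (by positivity)]; linarith
  have h4 : (N : ℝ) / L ^ 3 ≤ N / 8 := by gcongr
  have hle : h + 3 ≤ N := by
    have : (h : ℝ) + 3 < N + 1 := by linarith
    have : h + 3 < N + 1 := by exact_mod_cast this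
    omega
  obtain ⟨M, hM⟩ : ∃ M, N = M + h := ⟨N - h, by omega⟩
  have hM3 : 3 ≤ M := by omega
  have hh0 : (0 : ℝ) < h := by linarith
  have s1 := abs_le.mp (hS N (by omega))
  have s2 := abs_le.mp (hS M hM3)
  change -(_) ≤ SS N ∧ SS N ≤ _ at s1
  change -(_) ≤ SS M ∧ SS M ≤ _ at s2
  have hMN : (M : ℝ) ≤ N := by rw [hM]; push_cast; linarith
  have hMN2 : (M : ℝ) ^ 2 ≤ N ^ 2 := by gcongr
  have s3 := SS_add M h
  rw [← hM] at s3
  have s4 : ∑ j ∈ Finset.range h, sumA (M + 1 + j) ≤ h * (sumA N + h * L ^ 6) := by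
    have := Finset.sum_le_card_nsmul (Finset.range h) (fun j => sumA (M + 1 + j)) (sumA N + h * L ^ 6) ?_
    · simpa only [Finset.card_range, nsmul_eq_mul] using this
    intro j hj
    have hj := Finset.mem_range.mp hj
    have := sumA_le (M + 1 + j) (h - 1 - j)
    rw [show M + 1 + j + (h - 1 - j) = N by omega, ← hLdef] at this
    have hc : ((h - 1 - j : ℕ) : ℝ) ≤ h := by exact_mod_cast (by omega : h - 1 - j ≤ h)
    have : ((h - 1 - j : ℕ) : ℝ) * L ^ 6 ≤ h * L ^ 6 := by gcongr
    linarith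
  have s5 : -(2 * K * N ^ 2) ≤ h * (sumA N + h * L ^ 6) := by nlinarith
  have s6 : -(2 * K * (N * L ^ 3)) * h ≤ (sumA N + h * L ^ 6) * h := by
    have : (N : ℝ) ≤ L ^ 3 * h := by
      rw [div_le_iff₀ (by positivity)] at h1; linarith
    have : (2 * K * N) * (N : ℝ) ≤ (2 * K * N) * (L ^ 3 * h) := by gcongr
    nlinarith
  have s7 := le_of_mul_le_mul_right s6 hh0
  have s8 : h * L ^ 6 ≤ 2 * (N * L ^ 3) := by
    have : (h : ℝ) ≤ 2 * (N / L ^ 3) := by linarith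
    calc h * L ^ 6 ≤ 2 * (N / L ^ 3) * L ^ 6 := by gcongr
      _ = _ := by field_simp
  linarith

open Classical in
noncomputable def br (n : ℕ) : ℝ :=
  ((if n.Prime then Real.log n else 0) - 1) * Real.log n ^ 6
noncomputable def sumB (N : ℕ) : ℝ := ∑ n ∈ Finset.range N, br n

lemma sumA_sub_sumB (N : ℕ) (hN : 1 ≤ N) :
    sumA N - sumB N ≤ 2 * √N * Real.log N * Real.log N ^ 6 := by
  have h1 := Chebyshev.psi_sub_theta_le (x := N) (by exact_mod_cast hN)
  rw [Chebyshev.psi_sub_theta_eq_sum_not_prime, Nat.floor_natCast] at h1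
  rw [sumA, sumB, ← Finset.sum_sub_distrib]
  calc ∑ n ∈ Finset.range N, (ar n - br n)
      ≤ ∑ n ∈ Finset.range N, (if ¬ n.Prime then ArithmeticFunction.vonMangoldt n else 0) * Real.log N ^ 6 := by
        refine Finset.sum_le_sum fun n hn => ?_
        have hn' := Finset.mem_range.mp hn
        rw [ar, br]
        by_cases hp : n.Prime
        · simp [hp, ArithmeticFunction.vonMangoldt_apply_prime hp]
        · simp only [hp, if_false, not_false_eq_true, if_true]
          rcases Nat.eq_zero_or_pos n with h | h
          · subst h; simp
          have h1 : 0 ≤ ArithmeticFunction.vonMangoldt n := ArithmeticFunction.vonMangoldt_nonneg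
          have h2 : 0 ≤ Real.log n := Real.log_natCast_nonneg n
          have h3 : Real.log n ≤ Real.log N :=
            Real.log_le_log (by exact_mod_cast h) (by exact_mod_cast hn'.le)
          have h4 : Real.log n ^ 6 ≤ Real.log N ^ 6 := by gcongr
          nlinarith
    _ = (∑ n ∈ Finset.range N with ¬ n.Prime, ArithmeticFunction.vonMangoldt n) * Real.log N ^ 6 := by
        rw [← Finset.sum_mul, Finset.sum_filter]
    _ ≤ (∑ n ∈ Finset.Ioc 0 N with ¬ n.Prime, ArithmeticFunction.vonMangoldt n) * Real.log N ^ 6 := by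
        have hl : 0 ≤ Real.log N := Real.log_natCast_nonneg N
        refine mul_le_mul_of_nonneg_right ?_ (by positivity)
        rw [Finset.sum_filter, Finset.sum_filter]
        have hsub : Finset.Ioo 0 N ⊆ Finset.Ioc 0 N := Finset.Ioo_subset_Ioc_self
        have hsub2 : Finset.Ioo 0 N ⊆ Finset.range N := fun x hx => by
          simp only [Finset.mem_Ioo, Finset.mem_range] at *; exact hx.2
        rw [← Finset.sum_subset hsub2]
        · refine Finset.sum_le_sum_of_subset_of_nonneg hsub fun i _ _ => ?_
          split_ifs
          · exact le_rfl
          · exact ArithmeticFunction.vonMangoldt_nonneg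
        · intro x hx hx'
          have : x = 0 := by
            simp only [Finset.mem_Ioo, Finset.mem_range] at *; omega
          subst this
          simp
    _ ≤ _ := by
        have hl : 0 ≤ Real.log N := Real.log_natCast_nonneg N
        gcongr

lemma sumB_lower : ∃ C : ℝ, 0 < C ∧ ∀ᶠ N : ℕ in atTop, -(C * (N * Real.log N ^ 3)) ≤ sumB N := by
  obtain ⟨C, hC, h⟩ := sumA_lower
  refine ⟨C + 1, by positivity, ?_⟩
  filter_upwards [h, log_pow_le 8 4, eventually_ge_atTop 1] with N h1 h2 h3
  have h4 := sumA_sub_sumB N h3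
  have hl : 0 ≤ Real.log N := Real.log_natCast_nonneg N
  have h5 : 2 * Real.log N ^ 4 ≤ √N := by
    apply Real.le_sqrt_of_sq_le
    nlinarith
  have h6 : 2 * √N * Real.log N * Real.log N ^ 6 ≤ N * Real.log N ^ 3 := by
    calc 2 * √N * Real.log N * Real.log N ^ 6 = √N * (2 * Real.log N ^ 4) * Real.log N ^ 3 := by ring
      _ ≤ √N * √N * Real.log N ^ 3 := by gcongr
      _ = _ := by rw [Real.mul_self_sqrt (by positivity)]
  linarith

noncomputable def ff (N : ℕ) : ℝ := N / (Real.log N - 1)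

/-- one-step inequality -/
lemma step_ineq (C : ℝ) (hC : 0 < C) : ∀ᶠ N : ℕ in atTop,
    ff (N + 1) - ff N + C * (((N + 1 : ℕ) : ℝ) * Real.log ((N + 1 : ℕ)) ^ 3 - N * Real.log N ^ 3) / Real.log N ^ 7
      + (Real.log ((N + 1 : ℕ)) - Real.log N) ≤ 1 / Real.log N := by
  filter_upwards [log_ge 3, log_ge (30 * C), log_pow_le 3 4, eventually_ge_atTop 8] with N hL hLC hL3 hN
  have hN8 : (8 : ℝ) ≤ N := by exact_mod_cast hN
  have hN0 : (0 : ℝ) < N := by linarith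
  obtain ⟨δ, hδ⟩ : ∃ δ, δ = Real.log ((N + 1 : ℕ)) - Real.log N := ⟨_, rfl⟩
  have hδ1 : δ ≤ 1 / N := by
    rw [hδ, ← Real.log_div (by positivity) (by positivity)]
    refine (Real.log_le_sub_one_of_pos (by positivity)).trans (le_of_eq ?_)
    push_cast; field_simp; ring
  have hδ2 : 1 / ((N : ℝ) + 1) ≤ δ := by
    rw [hδ, ← Real.log_div (by positivity) (by positivity)]
    refine (le_of_eq ?_).trans (Real.one_sub_inv_le_log_of_pos (by positivity))
    push_cast; field_simp; ring
  have hlog : Real.log ((N + 1 : ℕ)) = Real.log N + δ := by rw [hδ]; ring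
  rw [ff, ff, hlog]
  push_cast
  set L := Real.log N with hLdef
  have hδ0 : 0 < δ := lt_of_lt_of_le (by positivity) hδ2
  have hNδ : N * δ ≤ 1 := by rw [le_div_iff₀ hN0] at hδ1; linarith
  have hδle : δ ≤ 1 := by nlinarith
  have hNδ2 : 1 - 1 / N ≤ N * δ := by
    have : (N : ℝ) * (1 / (N + 1)) ≤ N * δ := by gcongr
    have h' : 1 - 1 / (N : ℝ) ≤ N * (1 / (N + 1)) := by
      rw [mul_one_div, sub_le_iff_le_add, div_add_div _ _ (by positivity) (by positivity),
        le_div_iff₀ (by positivity)]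
      nlinarith
    linarith
  -- bound for the difference of ff
  have b1 : ((N : ℝ) + 1) / (L + δ - 1) - N / (L - 1) ≤ (L - 2 + 1 / N) / (L - 1) ^ 2 := by
    have e : ((N : ℝ) + 1) / (L + δ - 1) - N / (L - 1) =
        (L - 1 - N * δ) / ((L + δ - 1) * (L - 1)) := by
      rw [div_sub_div _ _ (by linarith) (by linarith)]; congr 1; ring
    rw [e]
    have : 0 ≤ L - 1 - N * δ := by linarith
    have hL1 : 0 < L - 1 := by linarith
    apply div_le_div₀ _ _ (by positivity) _
    · have : 0 < 1 / (N : ℝ) := by positivity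
      linarith
    · linarith
    · rw [sq]; gcongr; linarith
  have b2 : ((N : ℝ) + 1) * (L + δ) ^ 3 - N * L ^ 3 ≤ 15 * L ^ 3 := by
    have a1 : (L + δ) ^ 3 ≤ (2 * L) ^ 3 := by gcongr; linarith
    have a2 : N * (L + δ) ^ 3 - N * L ^ 3 = (N * δ) * (3 * L ^ 2 + 3 * L * δ + δ ^ 2) := by ring
    have a3 : 3 * L ^ 2 + 3 * L * δ + δ ^ 2 ≤ 3 * L ^ 2 + 3 * L * 1 + 1 ^ 2 := by gcongr
    have a4 : (N * δ) * (3 * L ^ 2 + 3 * L * δ + δ ^ 2) ≤ 1 * (3 * L ^ 2 + 3 * L * 1 + 1 ^ 2) := by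
      gcongr
    have a5 : 3 * L ^ 2 ≤ L ^ 3 := by nlinarith [sq_nonneg L]
    nlinarith
  have b3 : C * (((N : ℝ) + 1) * (L + δ) ^ 3 - N * L ^ 3) / L ^ 7 ≤ 1 / (2 * L ^ 3) := by
    calc _ ≤ C * (15 * L ^ 3) / L ^ 7 := by gcongr
      _ ≤ _ := by
        rw [div_le_div_iff₀ (by positivity) (by positivity)]
        have : (30 * C) * L ^ 6 ≤ L * L ^ 6 := by gcongr
        nlinarith
  have b4 : 2 / (N : ℝ) ≤ 1 / (2 * L ^ 3) := by
    rw [div_le_div_iff₀ (by positivity) (by positivity)]; linarith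
  have b5 : (L - 2 + 1 / N) / (L - 1) ^ 2 ≤ 1 / L - 1 / L ^ 3 + 1 / N := by
    have hL1 : 0 < L - 1 := by linarith
    rw [add_div]
    have c1 : (1 / (N : ℝ)) / (L - 1) ^ 2 ≤ 1 / N := by
      apply div_le_self (by positivity)
      nlinarith
    have c2 : (L - 2) / (L - 1) ^ 2 ≤ 1 / L - 1 / L ^ 3 := by
      rw [show 1 / L - 1 / L ^ 3 = (L ^ 2 - 1) / L ^ 3 by field_simp,
        div_le_div_iff₀ (by positivity) (by positivity)]
      nlinarith
    linarith
  have b6 : 1 / L ^ 3 = 1 / (2 * L ^ 3) + 1 / (2 * L ^ 3) := by field_simp; norm_num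
  have b7 : 2 / (N : ℝ) = 1 / N + 1 / N := by ring
  linarith

noncomputable def PP (N : ℕ) : ℝ := (Nat.count Nat.Prime N : ℕ)

lemma PP_succ (N : ℕ) (hN : 2 ≤ N) : PP (N + 1) - PP N - br N / Real.log N ^ 7 = 1 / Real.log N := by
  have hl : 0 < Real.log N := Real.log_pos (by exact_mod_cast (by omega : 1 < N))
  rw [PP, PP, Nat.count_succ, br]
  by_cases hp : N.Prime
  · simp only [hp, if_true]; push_cast; field_simp; ring
  · simp only [hp, if_false]; push_cast; field_simp; ring

theorem count_gt : ∀ᶠ N : ℕ in atTop, (N : ℝ) / (Real.log N - 1) < Nat.count Nat.Prime N := by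
  obtain ⟨C, hC, hB⟩ := sumB_lower
  let D : ℕ → ℝ := fun N => sumB N + C * (N * Real.log N ^ 3)
  let Φ : ℕ → ℝ := fun N => PP N - ff N - D N / Real.log N ^ 7 - Real.log N
  obtain ⟨N0, hN0⟩ := eventually_atTop.mp (hB.and ((step_ineq C hC).and (eventually_ge_atTop 2)))
  have hD : ∀ N ≥ N0, 0 ≤ D N := fun N hN => by have := (hN0 N hN).1; simp only [D]; linarith
  have hstep : ∀ N ≥ N0, Φ N ≤ Φ (N + 1) := by
    intro N hN
    obtain ⟨-, h2, h3⟩ := hN0 N hN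
    have hl : 0 < Real.log N := Real.log_pos (by exact_mod_cast (by omega : 1 < N))
    have hll : Real.log N ≤ Real.log ((N + 1 : ℕ)) :=
      Real.log_le_log (by exact_mod_cast (by omega : 0 < N)) (by push_cast; linarith)
    have e1 : D (N + 1) / Real.log ((N + 1 : ℕ)) ^ 7 ≤ D (N + 1) / Real.log N ^ 7 := by
      have := hD (N + 1) (by omega)
      gcongr
    have e2 : D (N + 1) / Real.log N ^ 7 = D N / Real.log N ^ 7 + br N / Real.log N ^ 7 +
        C * (((N + 1 : ℕ) : ℝ) * Real.log ((N + 1 : ℕ)) ^ 3 - N * Real.log N ^ 3) / Real.log N ^ 7 := by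
      simp only [D]
      rw [sumB, Finset.sum_range_succ, ← sumB]
      ring
    have e3 := PP_succ N h3
    simp only [Φ]
    linarith
  have hmono : ∀ N ≥ N0, Φ N0 ≤ Φ N := by
    intro N hN
    induction N, hN using Nat.le_induction with
    | base => exact le_rfl
    | succ n hn ih => exact ih.trans (hstep n hn)
  filter_upwards [eventually_ge_atTop N0, log_ge (1 - Φ N0), eventually_ge_atTop 2] with N h1 h2 h3
  have h4 := hmono N h1
  have h5 := hD N h1
  have hl : 0 < Real.log N := Real.log_pos (by exact_mod_cast (by omega : 1 < N))
  have h6 : 0 ≤ D N / Real.log N ^ 7 := by positivity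
  change ff N < PP N
  have h7 : Φ N = PP N - ff N - D N / Real.log N ^ 7 - Real.log N := rfl
  linarith

end PNT


namespace PNT

lemma p_tendsto : Tendsto p atTop atTop := by
  have h1 : StrictMono (Nat.nth Nat.Prime) := Nat.nth_strictMono Nat.infinite_setOfPred_prime
  exact h1.tendsto_atTop.comp (tendsto_sub_atTop_nat 1)

lemma p_prime (n : ℕ) : (p n).Prime := Nat.prime_nth_prime _

/-- the consequence of the prime number theorem -/
lemma p_lt : ∀ᶠ n : ℕ in atTop, (p n : ℝ) < n * (Real.log (p n) - 1) := by
  filter_upwards [p_tendsto.eventually count_gt, p_tendsto.eventually (log_ge 2),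
    eventually_ge_atTop 1] with n h1 h2 h3
  have hc : Nat.count Nat.Prime (p n) = n - 1 := Nat.count_nth_of_infinite Nat.infinite_setOfPred_prime _
  rw [hc, div_lt_iff₀ (by linarith)] at h1
  refine h1.trans_le ?_
  have : ((n - 1 : ℕ) : ℝ) ≤ n := by exact_mod_cast Nat.sub_le _ _
  gcongr
  linarith

lemma final_ineq (c P q n L : ℝ) (hc : 0 < c) (hP : 0 < P) (hq : 0 < q) (hn : 1 ≤ n)
    (hLdef : L = Real.log P) (hL : 2 ≤ L) (hPn : P < n * (L - 1))
    (hbig : ((1 + 2 * c + 4 * c ^ 2) ^ 2 + (c + 4 * c ^ 2)) * L ^ 4 ≤ P)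
    (h : P ^ (1 / n) > (1 - c * L / n ^ 2) * q ^ (1 / (n + 1))) :
    q - P < (1 + c) * (L ^ 2 - L) + 1 := by
  obtain ⟨K, hK⟩ : ∃ K, K = (1 + 2 * c + 4 * c ^ 2) ^ 2 + (c + 4 * c ^ 2) := ⟨_, rfl⟩
  rw [← hK] at hbig
  have hK1 : 1 + 2 * c + 4 * c ^ 2 ≤ K := by
    rw [hK]; nlinarith [sq_nonneg c, mul_pos hc hc]
  have hK0 : 0 < K := lt_of_lt_of_le (by positivity) hK1
  have hn0 : 0 < n := by linarith
  have hL0 : 0 < L := by linarith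
  have hnK : K * L ^ 3 ≤ n := by
    have h1 : P < n * L := by nlinarith
    have h2 : (K * L ^ 3) * L ≤ n * L := by nlinarith
    exact le_of_mul_le_mul_right h2 hL0
  have hnK1 : (1 + 2 * c + 4 * c ^ 2) * L ≤ n := by
    have h1 : (1 + 2 * c + 4 * c ^ 2) * L ≤ K * L := by gcongr
    have h2 : L ≤ L ^ 3 := by
      calc L = L ^ 1 := (pow_one L).symm
        _ ≤ L ^ 3 := pow_le_pow_right₀ (by linarith) (by norm_num)
    have h3 : K * L ≤ K * L ^ 3 := by gcongr
    linarith
  have hLn : L ≤ n := by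
    have : 0 ≤ (2 * c + 4 * c ^ 2) * L := by positivity
    nlinarith
  obtain ⟨u, hu⟩ : ∃ u, u = c * L / n ^ 2 := ⟨_, rfl⟩
  rw [← hu] at h
  have hu0 : 0 < u := by rw [hu]; positivity
  have hu2 : u ≤ 1 / 2 := by
    rw [hu, div_le_div_iff₀ (by positivity) (by norm_num)]
    have : 0 ≤ (1 + 4 * c ^ 2) * L := by positivity
    nlinarith
  have hlogu : -u - 2 * u ^ 2 ≤ Real.log (1 - u) := by
    refine le_trans ?_ (Real.one_sub_inv_le_log_of_pos (by linarith : (0:ℝ) < 1 - u))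
    have : (1 - u)⁻¹ ≤ 1 + u + 2 * u ^ 2 := by
      rw [inv_le_iff_one_le_mul₀ (by linarith)]
      nlinarith [sq_nonneg u]
    linarith
  have hlog : Real.log (1 - u) + 1 / (n + 1) * Real.log q < 1 / n * L := by
    have h1 : Real.log ((1 - u) * q ^ (1 / (n + 1))) < Real.log (P ^ (1 / n)) :=
      Real.log_lt_log (mul_pos (by linarith) (Real.rpow_pos_of_pos hq _)) h
    rw [Real.log_mul (by linarith) (Real.rpow_pos_of_pos hq _).ne', Real.log_rpow hq,
      Real.log_rpow hP, ← hLdef] at h1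
    exact h1
  obtain ⟨v, hv⟩ : ∃ v, v = L / n + (n + 1) * (u + 2 * u ^ 2) := ⟨_, rfl⟩
  have hv0 : 0 < v := by rw [hv]; positivity
  have hqv : Real.log q - L < v := by
    have h1 : 1 / (n + 1) * Real.log q < 1 / n * L + (u + 2 * u ^ 2) := by linarith
    have h2 : (n + 1) * (1 / (n + 1) * Real.log q) < (n + 1) * (1 / n * L + (u + 2 * u ^ 2)) := by
      gcongr
    have e1 : (n + 1) * (1 / (n + 1) * Real.log q) = Real.log q := by field_simp
    have e2 : (n + 1) * (1 / n * L + (u + 2 * u ^ 2)) = L + v := by rw [hv]; field_simp; ring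
    rw [e1, e2] at h2
    linarith
  have hvb : v ≤ (1 + c) * L / n + (c + 4 * c ^ 2) * L ^ 2 / n ^ 2 := by
    have e1 : (n + 1) * u = c * L / n + c * L / n ^ 2 := by rw [hu]; field_simp
    have e2 : (n + 1) * (2 * u ^ 2) ≤ 4 * c ^ 2 * L ^ 2 / n ^ 2 := by
      calc (n + 1) * (2 * u ^ 2) ≤ (n + n) * (2 * u ^ 2) := by gcongr
        _ = 4 * c ^ 2 * L ^ 2 / n ^ 3 := by rw [hu]; field_simp; ring
        _ ≤ _ := by gcongr <;> norm_num
    have e3 : c * L / n ^ 2 ≤ c * L ^ 2 / n ^ 2 := by gcongr; nlinarith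
    have e4 : (1 + c) * L / n = L / n + c * L / n := by ring
    have e5 : (c + 4 * c ^ 2) * L ^ 2 / n ^ 2 = c * L ^ 2 / n ^ 2 + 4 * c ^ 2 * L ^ 2 / n ^ 2 := by ring
    rw [hv, mul_add, e1, e4, e5]
    linarith
  have hvb2 : v ≤ (1 + 2 * c + 4 * c ^ 2) * L / n := by
    have e1 : (c + 4 * c ^ 2) * L ^ 2 / n ^ 2 ≤ (c + 4 * c ^ 2) * L / n := by
      rw [div_le_div_iff₀ (by positivity) (by positivity)]
      have : ((c + 4 * c ^ 2) * L * n) * L ≤ ((c + 4 * c ^ 2) * L * n) * n := by gcongr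
      nlinarith
    have e2 : (1 + 2 * c + 4 * c ^ 2) * L / n = (1 + c) * L / n + (c + 4 * c ^ 2) * L / n := by ring
    linarith
  have hv1 : v ≤ 1 := hvb2.trans (by rw [div_le_one hn0]; exact hnK1)
  have hexp : Real.exp v ≤ 1 + v + v ^ 2 := by
    have := (abs_le.mp (Real.abs_exp_sub_one_sub_id_le (x := v) (by rw [abs_of_pos hv0]; exact hv1))).2
    linarith
  have hqP : q < P * Real.exp v := by
    have h1 : Real.log q < L + v := by linarith
    rw [← Real.exp_lt_exp, Real.exp_log hq, Real.exp_add, hLdef, Real.exp_log hP] at h1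
    exact h1
  have hvv : v + v ^ 2 ≤ (1 + c) * L / n + K * L ^ 2 / n ^ 2 := by
    have e1 : v ^ 2 ≤ ((1 + 2 * c + 4 * c ^ 2) * L / n) ^ 2 := by gcongr
    have e2 : K * L ^ 2 / n ^ 2 = ((1 + 2 * c + 4 * c ^ 2) * L / n) ^ 2 +
        (c + 4 * c ^ 2) * L ^ 2 / n ^ 2 := by rw [hK]; field_simp
    linarith
  have hx : P / n < L - 1 := by rw [div_lt_iff₀ hn0]; linarith
  have hx0 : 0 < P / n := by positivity
  calc q - P < P * (v + v ^ 2) := by nlinarith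
    _ ≤ P * ((1 + c) * L / n + K * L ^ 2 / n ^ 2) := by gcongr
    _ = (P / n) * ((1 + c) * L) + (P / n) * (K * L ^ 2 / n) := by field_simp
    _ ≤ (L - 1) * ((1 + c) * L) + L * (K * L ^ 2 / n) := by gcongr; linarith
    _ = (1 + c) * (L ^ 2 - L) + K * L ^ 3 / n := by ring
    _ ≤ _ := by
      have : K * L ^ 3 / n ≤ 1 := by rw [div_le_one hn0]; exact hnK
      linarith

end PNT

theorem stmt_1
    (c₀ : ℝ) (hc₀ : 0 < c₀)
    (h : ∀ᶠ n : ℕ in atTop,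
      (p n : ℝ) ^ ((1 : ℝ) / n) >
        (1 - c₀ * Real.log (p n) / n ^ 2) * (p (n + 1) : ℝ) ^ ((1 : ℝ) / (n + 1))) :
    ∃ N : ℕ, ∀ n > N,
      (p (n + 1) : ℝ) - p n <
        (1 + c₀) * ((Real.log (p n)) ^ 2 - Real.log (p n)) + 1 := by
  
  have hev : ∀ᶠ n : ℕ in atTop, (p (n + 1) : ℝ) - p n <
        (1 + c₀) * ((Real.log (p n)) ^ 2 - Real.log (p n)) + 1 := by
    filter_upwards [h, PNT.p_lt, PNT.p_tendsto.eventually (PNT.log_ge 2),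
      PNT.p_tendsto.eventually (PNT.log_pow_le 4
        ((1 + 2 * c₀ + 4 * c₀ ^ 2) ^ 2 + (c₀ + 4 * c₀ ^ 2))),
      eventually_ge_atTop 1] with n h1 h2 h3 h4 h5
    exact PNT.final_ineq c₀ (p n) (p (n + 1)) n (Real.log (p n)) hc₀
      (by exact_mod_cast (PNT.p_prime n).pos) (by exact_mod_cast (PNT.p_prime (n + 1)).pos)
      (by exact_mod_cast h5) rfl h3 h2 h4 h1
  obtain ⟨N, hN⟩ := eventually_atTop.mp hev
  exact ⟨N, fun n hn => hN n hn.le⟩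
end
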